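/- Let n ≥ 2 and let (u,v) be a solution of Δu = u v², Δv = v u², u > 0, v > 0 on ℝⁿ satisfying the linear growth condition u(x) + v(x) ≤ C₀(1 + |x|) for some constant C₀ > 0. Then there exists a constant C > 0 such that for every x ∈ ℝⁿ with u(x) = v(x) and every r ≥ 1, 1/C ≤ J(r; x) ≤ C. -/

import Mathlib

open MeasureTheory Metric
open scoped RealInnerProductSpace

noncomputable section

/-- The Laplacian of a function on Euclidean space, as the trace of the second derivative. -/
def lap {n : ℕ} (u : EuclideanSpace ℝ (Fin n) → ℝ) (x : EuclideanSpace ℝ (Fin n)) : ℝ :=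
  ∑ i : Fin n, iteratedFDeriv ℝ 2 u x (fun _ => EuclideanSpace.single i 1)

/-- A (positive classical) solution of the system Δu = u v², Δv = v u², u,v > 0 on ℝⁿ. -/
def IsSolution {n : ℕ} (u v : EuclideanSpace ℝ (Fin n) → ℝ) : Prop :=
  ContDiff ℝ (⊤ : ℕ∞) u ∧ ContDiff ℝ (⊤ : ℕ∞) v ∧ (∀ x, 0 < u x) ∧ (∀ x, 0 < v x) ∧
    (∀ x, lap u x = u x * v x ^ 2) ∧ (∀ x, lap v x = v x * u x ^ 2)

/-- The Alt–Caffarelli–Friedman quantity J(r; x). -/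
def Jfun {n : ℕ} (u v : EuclideanSpace ℝ (Fin n) → ℝ) (x : EuclideanSpace ℝ (Fin n)) (r : ℝ) :
    ℝ :=
  r ^ (-4 : ℝ) *
    ((∫ y in ball x r,
        (‖gradient u y‖ ^ 2 + (u y) ^ 2 * (v y) ^ 2) * ‖x - y‖ ^ ((2 : ℝ) - n)) *
     (∫ y in ball x r,
        (‖gradient v y‖ ^ 2 + (u y) ^ 2 * (v y) ^ 2) * ‖x - y‖ ^ ((2 : ℝ) - n)))

/-! ### Second derivatives and the Laplacian -/

/-- The second derivative of `u` at `x` in the direction `p`. -/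
def dirTwo {n : ℕ} (u : EuclideanSpace ℝ (Fin n) → ℝ) (p x : EuclideanSpace ℝ (Fin n)) : ℝ :=
  fderiv ℝ (fun y => fderiv ℝ u y p) x p

theorem contDiff_fderiv_apply {n : ℕ} {u : EuclideanSpace ℝ (Fin n) → ℝ}
    (hu : ContDiff ℝ (⊤ : ℕ∞) u) (p : EuclideanSpace ℝ (Fin n)) :
    ContDiff ℝ (⊤ : ℕ∞) (fun y => fderiv ℝ u y p) :=
  (hu.fderiv_right (m := (⊤ : ℕ∞)) le_rfl).clm_apply contDiff_const

theorem iteratedFDeriv_two_const {n : ℕ} {u : EuclideanSpace ℝ (Fin n) → ℝ}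
    (hu : ContDiff ℝ (⊤ : ℕ∞) u) (p x : EuclideanSpace ℝ (Fin n)) :
    iteratedFDeriv ℝ 2 u x (fun _ => p) = dirTwo u p x := by
  have hd : DifferentiableAt ℝ (fderiv ℝ u) x :=
    ((hu.fderiv_right (m := (⊤ : ℕ∞)) le_rfl).differentiable (by simp)) x
  rw [iteratedFDeriv_two_apply, dirTwo]
  rw [show (fun y => fderiv ℝ u y p) = fun y => (fderiv ℝ u y) ((fun _ => p) y) from rfl]
  rw [fderiv_clm_apply hd (by fun_prop)]
  simp

theorem lap_eq_sum_dirTwo {n : ℕ} {u : EuclideanSpace ℝ (Fin n) → ℝ}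
    (hu : ContDiff ℝ (⊤ : ℕ∞) u) (b : OrthonormalBasis (Fin n) ℝ (EuclideanSpace ℝ (Fin n)))
    (x : EuclideanSpace ℝ (Fin n)) : lap u x = ∑ i, dirTwo u (b i) x := by
  have h1 : ∀ b : OrthonormalBasis (Fin n) ℝ (EuclideanSpace ℝ (Fin n)),
      Laplacian.laplacian u x = ∑ i, dirTwo u (b i) x := by
    intro b
    rw [InnerProductSpace.laplacian_eq_iteratedFDeriv_orthonormalBasis u b]
    refine Finset.sum_congr rfl fun i _ => ?_
    rw [← iteratedFDeriv_two_const hu]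
    congr 1
    ext j
    fin_cases j <;> rfl
  rw [← h1 b, h1 (EuclideanSpace.basisFun (Fin n) ℝ), lap]
  refine Finset.sum_congr rfl fun i _ => ?_
  rw [iteratedFDeriv_two_const hu]
  simp

theorem dirTwo_neg {n : ℕ} (u : EuclideanSpace ℝ (Fin n) → ℝ) (p x : EuclideanSpace ℝ (Fin n)) :
    dirTwo u (-p) x = dirTwo u p x := by
  simp only [dirTwo, map_neg]
  rw [fderiv_fun_neg]
  simp

theorem hasDerivAt_line {n : ℕ} {u : EuclideanSpace ℝ (Fin n) → ℝ} (hu : Differentiable ℝ u)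
    (x p : EuclideanSpace ℝ (Fin n)) (t : ℝ) :
    HasDerivAt (fun t : ℝ => u (x + t • p)) (fderiv ℝ u (x + t • p) p) t := by
  have h : HasDerivAt (fun t : ℝ => x + t • p) p t := by
    simpa using ((hasDerivAt_id t).smul_const p).const_add x
  exact (hu _).hasFDerivAt.comp_hasDerivAt t h

theorem hasDerivAt_fderiv_line {n : ℕ} {u : EuclideanSpace ℝ (Fin n) → ℝ}
    (hu : ContDiff ℝ (⊤ : ℕ∞) u) (x p : EuclideanSpace ℝ (Fin n)) :
    HasDerivAt (fun t : ℝ => fderiv ℝ u (x + t • p) p) (dirTwo u p x) 0 := by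
  have hd : Differentiable ℝ (fun y => fderiv ℝ u y p) :=
    (contDiff_fderiv_apply hu p).differentiable (by simp)
  simpa [dirTwo] using hasDerivAt_line hd x p 0

/-! ### One-dimensional derivative tests -/

theorem second_derivative_test {f f' : ℝ → ℝ} {f2 : ℝ}
    (hf : ∀ᶠ t in nhds (0 : ℝ), HasDerivAt f (f' t) t) (hf' : HasDerivAt f' f2 0)
    (hmax : IsLocalMax f 0) : f' 0 = 0 ∧ f2 ≤ 0 := by
  have h0 : f' 0 = 0 := hmax.hasDerivAt_eq_zero hf.self_of_nhds
  refine ⟨h0, ?_⟩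
  by_contra! hpos
  have hev : deriv f =ᶠ[nhds 0] f' := hf.mono fun t ht => ht.deriv
  have hdd : deriv (deriv f) 0 = f2 := by rw [hev.deriv_eq, hf'.deriv]
  have hs := eventually_nhdsWithin_sign_eq_of_deriv_pos (f := deriv f) (x₀ := 0)
    (by rw [hdd]; exact hpos) (by rw [hf.self_of_nhds.deriv, h0])
  have h1 : ∀ᶠ t in nhds (0 : ℝ), 0 < t → 0 < f' t := by
    filter_upwards [hs, hev] with t ht hte hpt
    rw [hte] at ht
    rw [sub_zero, sign_pos hpt] at ht
    exact sign_eq_one_iff.1 ht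
  obtain ⟨ε, hε, hball⟩ := Metric.eventually_nhds_iff_ball.1 ((h1.and hf).and hmax)
  have hin : ∀ t ∈ Set.Icc (0 : ℝ) (ε / 2), t ∈ Metric.ball (0 : ℝ) ε := by
    intro t ht
    rw [Metric.mem_ball, Real.dist_eq, sub_zero, abs_of_nonneg ht.1]
    linarith [ht.2]
  have hmono : StrictMonoOn f (Set.Icc 0 (ε / 2)) := by
    refine strictMonoOn_of_deriv_pos (convex_Icc _ _)
      (fun t ht => (hball t (hin t ht)).1.2.continuousAt.continuousWithinAt) ?_
    intro t ht
    rw [interior_Icc] at ht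
    have := hball t (hin t ⟨ht.1.le, ht.2.le⟩)
    rw [this.1.2.deriv]
    exact this.1.1 ht.1
  have hlt := hmono (Set.left_mem_Icc.2 (by linarith)) (Set.right_mem_Icc.2 (by linarith))
    (by linarith)
  exact absurd (hball (ε / 2) (hin _ ⟨by linarith, le_rfl⟩)).2 (not_le.2 hlt)

theorem one_sided_derivative_test {f : ℝ → ℝ} {f1 : ℝ} (hf : HasDerivAt f f1 0)
    (hmax : ∀ᶠ t in nhds (0 : ℝ), 0 < t → f t ≤ f 0) : f1 ≤ 0 := by
  have h := hf.hasDerivWithinAt (s := Set.Ioi 0)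
  rw [hasDerivWithinAt_iff_tendsto_slope' (by simp)] at h
  refine le_of_tendsto h ?_
  filter_upwards [nhdsWithin_le_nhds hmax, self_mem_nhdsWithin] with t ht htp
  rw [slope_def_field]
  exact div_nonpos_of_nonpos_of_nonneg (by linarith [ht htp]) (by simpa using (le_of_lt htp))


/-! ### The two-point maximum principle -/

/-- First and second derivative tests, along a line in the product space, for
`log u(x) + log v(y) - 2 log F(s)` with `F(s) = s - k s³`. -/
theorem two_point_line_test {n : ℕ} {u v : EuclideanSpace ℝ (Fin n) → ℝ}
    (hu : ContDiff ℝ (⊤ : ℕ∞) u) (hv : ContDiff ℝ (⊤ : ℕ∞) v) (hu0 : ∀ x, 0 < u x)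
    (hv0 : ∀ x, 0 < v x) {x y p q : EuclideanSpace ℝ (Fin n)} {s s' : ℝ → ℝ} {s2 k : ℝ}
    (hs : ∀ᶠ t in nhds (0 : ℝ), HasDerivAt s (s' t) t) (hs' : HasDerivAt s' s2 0)
    (hF : 0 < s 0 - k * s 0 ^ 3)
    (hle : ∀ᶠ t in nhds (0 : ℝ),
      Real.log (u (x + t • p)) + Real.log (v (y + t • q)) - 2 * Real.log (s t - k * s t ^ 3) ≤
        Real.log (u x) + Real.log (v y) - 2 * Real.log (s 0 - k * s 0 ^ 3)) :
    fderiv ℝ u x p / u x + fderiv ℝ v y q / v y =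
        2 * ((1 - 3 * k * s 0 ^ 2) * s' 0 / (s 0 - k * s 0 ^ 3)) ∧
      dirTwo u p x / u x - (fderiv ℝ u x p / u x) ^ 2 +
          (dirTwo v q y / v y - (fderiv ℝ v y q / v y) ^ 2) ≤
        2 * (((-(6 * k * s 0)) * s' 0 ^ 2 + (1 - 3 * k * s 0 ^ 2) * s2) / (s 0 - k * s 0 ^ 3) -
          ((1 - 3 * k * s 0 ^ 2) * s' 0 / (s 0 - k * s 0 ^ 3)) ^ 2) := by
  have hud : Differentiable ℝ u := hu.differentiable (by simp)
  have hvd : Differentiable ℝ v := hv.differentiable (by simp)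
  have hFev : ∀ᶠ t in nhds (0 : ℝ), 0 < s t - k * s t ^ 3 := by
    have hc : ContinuousAt s 0 := hs.self_of_nhds.continuousAt
    have : ContinuousAt (fun t => s t - k * s t ^ 3) 0 := by fun_prop
    exact this.eventually (lt_mem_nhds hF)
  have key := second_derivative_test
    (f := fun t => Real.log (u (x + t • p)) + Real.log (v (y + t • q)) -
      2 * Real.log (s t - k * s t ^ 3))
    (f' := fun t => fderiv ℝ u (x + t • p) p / u (x + t • p) +
      fderiv ℝ v (y + t • q) q / v (y + t • q) -
      2 * ((1 - 3 * k * s t ^ 2) * s' t / (s t - k * s t ^ 3)))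
    (f2 := dirTwo u p x / u x - (fderiv ℝ u x p / u x) ^ 2 +
          (dirTwo v q y / v y - (fderiv ℝ v y q / v y) ^ 2) -
        2 * (((-(6 * k * s 0)) * s' 0 ^ 2 + (1 - 3 * k * s 0 ^ 2) * s2) / (s 0 - k * s 0 ^ 3) -
          ((1 - 3 * k * s 0 ^ 2) * s' 0 / (s 0 - k * s 0 ^ 3)) ^ 2)) ?_ ?_ ?_
  · constructor
    · have := key.1
      simp only [zero_smul, add_zero] at this
      linarith
    · linarith [key.2]
  · filter_upwards [hs, hFev] with t ht hFt
    have h1 := (hasDerivAt_line hud x p t).log (hu0 _).ne'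
    have h2 := (hasDerivAt_line hvd y q t).log (hv0 _).ne'
    have h3 : HasDerivAt (fun t => s t - k * s t ^ 3) ((1 - 3 * k * s t ^ 2) * s' t) t := by
      refine (ht.sub ((ht.pow 3).const_mul k)).congr_deriv ?_
      push_cast
      ring
    exact (h1.add h2).sub ((h3.log hFt.ne').const_mul 2)
  · have hs0 := hs.self_of_nhds
    have h1 := (hasDerivAt_fderiv_line hu x p).div (hasDerivAt_line hud x p 0) (hu0 _).ne'
    have h2 := (hasDerivAt_fderiv_line hv y q).div (hasDerivAt_line hvd y q 0) (hv0 _).ne'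
    have h3 : HasDerivAt (fun t => s t - k * s t ^ 3) ((1 - 3 * k * s 0 ^ 2) * s' 0) 0 := by
      refine (hs0.sub ((hs0.pow 3).const_mul k)).congr_deriv ?_
      push_cast
      ring
    have h4 : HasDerivAt (fun t => (1 - 3 * k * s t ^ 2) * s' t)
        ((-(6 * k * s 0)) * s' 0 ^ 2 + (1 - 3 * k * s 0 ^ 2) * s2) 0 := by
      refine ((((hs0.pow 2).const_mul (3 * k)).const_sub 1).mul hs').congr_deriv ?_
      push_cast
      simp only [pow_one, Pi.pow_apply]
      ring
    have h5 := (h4.div h3 hF.ne').const_mul 2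
    refine ((h1.add h2).sub h5).congr_deriv ?_
    have hux := (hu0 x).ne'
    have hvy := (hv0 y).ne'
    simp only [zero_smul, add_zero]
    field_simp
  · filter_upwards [hle] with t ht
    simpa using ht

theorem hasDerivAt_inv_quadratic (τ D a t : ℝ) (h : D - 2 * t * a - t ^ 2 ≠ 0) :
    HasDerivAt (fun t => τ / (D - 2 * t * a - t ^ 2))
      (τ * (2 * a + 2 * t) / (D - 2 * t * a - t ^ 2) ^ 2) t := by
  have h1 : HasDerivAt (fun t : ℝ => D - 2 * t * a - t ^ 2) (-(2 * a + 2 * t)) t := by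
    have h2 : HasDerivAt (fun t : ℝ => 2 * t * a) (2 * a) t := by
      simpa using ((hasDerivAt_id t).const_mul 2).mul_const a
    have h3 : HasDerivAt (fun t : ℝ => t ^ 2) (2 * t) t := by simpa using hasDerivAt_pow 2 t
    refine ((h2.const_sub D).sub h3).congr_deriv ?_
    ring
  refine ((hasDerivAt_const t τ).div h1 h).congr_deriv ?_
  ring

theorem hasDerivAt_inv_quadratic_deriv (τ D a : ℝ) (h : D ≠ 0) :
    HasDerivAt (fun t => τ * (2 * a + 2 * t) / (D - 2 * t * a - t ^ 2) ^ 2)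
      (τ * (2 / D ^ 2 + 8 * a ^ 2 / D ^ 3)) 0 := by
  have h1 : HasDerivAt (fun t : ℝ => D - 2 * t * a - t ^ 2) (-(2 * a)) 0 := by
    have h2 : HasDerivAt (fun t : ℝ => 2 * t * a) (2 * a) 0 := by
      simpa using ((hasDerivAt_id (0 : ℝ)).const_mul 2).mul_const a
    have h3 : HasDerivAt (fun t : ℝ => t ^ 2) 0 0 := by simpa using hasDerivAt_pow 2 (0 : ℝ)
    refine ((h2.const_sub D).sub h3).congr_deriv ?_
    ring
  have h4 : HasDerivAt (fun t : ℝ => τ * (2 * a + 2 * t)) (τ * 2) 0 := by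
    have := (((hasDerivAt_id (0 : ℝ)).const_mul 2).const_add (2 * a)).const_mul τ
    simpa using this
  refine (h4.div (h1.pow 2) (by simpa using h)).congr_deriv ?_
  simp
  field_simp
  ring

/-- The scaled distance entering the two-point weight. -/
def twoPointDist {n : ℕ} (l : ℝ) (x y : EuclideanSpace ℝ (Fin n)) : ℝ :=
  (l + ‖x - y‖) / (1 - ‖(1 / 2 : ℝ) • (x + y)‖ ^ 2)

theorem cubic_mono {k a b κ : ℝ} (hk : 0 ≤ k) (hκ : 3 * k * κ ^ 2 ≤ 1) (ha : 0 ≤ a) (hab : a ≤ b)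
    (hb : b ≤ κ) : a - k * a ^ 3 ≤ b - k * b ^ 3 := by
  have h1 : k * (b ^ 2 + b * a + a ^ 2) ≤ 1 := by
    have : b ^ 2 + b * a + a ^ 2 ≤ 3 * κ ^ 2 := by nlinarith
    nlinarith
  nlinarith [mul_nonneg (sub_nonneg.2 hab) (sub_nonneg.2 h1)]


/-- The logarithm of the two-point quotient. -/
def twoPointLog {n : ℕ} (u v : EuclideanSpace ℝ (Fin n) → ℝ) (k l : ℝ)
    (x y : EuclideanSpace ℝ (Fin n)) : ℝ :=
  Real.log (u x) + Real.log (v y) -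
    2 * Real.log (twoPointDist l x y - k * twoPointDist l x y ^ 3)

theorem tendsto_two_lines {n : ℕ} (x y p q : EuclideanSpace ℝ (Fin n)) :
    Filter.Tendsto (fun t : ℝ => (x + t • p, y + t • q)) (nhds 0) (nhds (x, y)) := by
  have : ContinuousAt (fun t : ℝ => (x + t • p, y + t • q)) 0 := by fun_prop
  simpa [ContinuousAt] using this

theorem half_norm_add_smul_sq {n : ℕ} (x y b : EuclideanSpace ℝ (Fin n)) (hb : ‖b‖ = 1) (t : ℝ) :
    1 - ‖(1 / 2 : ℝ) • ((x + t • b) + (y + t • b))‖ ^ 2 =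
      (1 - ‖(1 / 2 : ℝ) • (x + y)‖ ^ 2) - 2 * t * ⟪(1 / 2 : ℝ) • (x + y), b⟫ - t ^ 2 := by
  have : (1 / 2 : ℝ) • ((x + t • b) + (y + t • b)) = (1 / 2 : ℝ) • (x + y) + t • b := by module
  rw [this, norm_add_sq_real, norm_smul t b, hb, inner_smul_right, mul_one, Real.norm_eq_abs, sq_abs]
  ring

theorem two_point_parallel {n : ℕ} {u v : EuclideanSpace ℝ (Fin n) → ℝ}
    (hu : ContDiff ℝ (⊤ : ℕ∞) u) (hv : ContDiff ℝ (⊤ : ℕ∞) v) (hu0 : ∀ x, 0 < u x)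
    (hv0 : ∀ x, 0 < v x) {x y b : EuclideanSpace ℝ (Fin n)} {k l s g a : ℝ}
    (hmax : ∀ᶠ z in nhds (x, y), twoPointLog u v k l z.1 z.2 ≤ twoPointLog u v k l x y)
    (hb : ‖b‖ = 1) (hD : 0 < 1 - ‖(1 / 2 : ℝ) • (x + y)‖ ^ 2)
    (hs : s = twoPointDist l x y) (hg : g = 1 / (1 - ‖(1 / 2 : ℝ) • (x + y)‖ ^ 2))
    (ha : a = ⟪(1 / 2 : ℝ) • (x + y), b⟫) (hF : 0 < s - k * s ^ 3) :
    fderiv ℝ u x b / u x + fderiv ℝ v y b / v y =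
        2 * ((1 - 3 * k * s ^ 2) * (2 * a * g * s) / (s - k * s ^ 3)) ∧
      dirTwo u b x / u x - (fderiv ℝ u x b / u x) ^ 2 +
          (dirTwo v b y / v y - (fderiv ℝ v y b / v y) ^ 2) ≤
        2 * (((-(6 * k * s)) * (2 * a * g * s) ^ 2 +
            (1 - 3 * k * s ^ 2) * (s * (2 * g + 8 * a ^ 2 * g ^ 2))) / (s - k * s ^ 3) -
          ((1 - 3 * k * s ^ 2) * (2 * a * g * s) / (s - k * s ^ 3)) ^ 2) := by
  set D := 1 - ‖(1 / 2 : ℝ) • (x + y)‖ ^ 2 with hDdef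
  set τ := l + ‖x - y‖ with hτ
  have hsτ : s = τ / D := by rw [hs, twoPointDist]
  have hDev : ∀ᶠ t in nhds (0 : ℝ), D - 2 * t * a - t ^ 2 ≠ 0 := by
    have : ContinuousAt (fun t : ℝ => D - 2 * t * a - t ^ 2) 0 := by fun_prop
    exact this.eventually_ne (by simpa using hD.ne')
  have h := two_point_line_test hu hv hu0 hv0 (x := x) (y := y) (p := b) (q := b)
    (s := fun t => τ / (D - 2 * t * a - t ^ 2))
    (s' := fun t => τ * (2 * a + 2 * t) / (D - 2 * t * a - t ^ 2) ^ 2) (k := k)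
    (hDev.mono fun t ht => hasDerivAt_inv_quadratic τ D a t ht)
    (hasDerivAt_inv_quadratic_deriv τ D a hD.ne')
    (by simpa [← hsτ] using hF)
    (by
      filter_upwards [(tendsto_two_lines x y b b).eventually hmax] with t ht
      have e1 : twoPointDist l (x + t • b) (y + t • b) = τ / (D - 2 * t * a - t ^ 2) := by
        rw [twoPointDist, half_norm_add_smul_sq x y b hb, ← ha, hτ]
        congr 3
        abel_nf
      simp only [twoPointLog, e1, ← hs] at ht
      simpa [← hsτ] using ht)
  have e1 : τ / (D - 2 * 0 * a - 0 ^ 2) = s := by rw [hsτ]; simp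
  have e2 : τ * (2 * a + 2 * 0) / (D - 2 * 0 * a - 0 ^ 2) ^ 2 = 2 * a * g * s := by
    have hD' := hD.ne'
    rw [hsτ, hg, show D - 2 * 0 * a - 0 ^ 2 = D by ring]
    field_simp
    ring
  have e3 : τ * (2 / D ^ 2 + 8 * a ^ 2 / D ^ 3) = s * (2 * g + 8 * a ^ 2 * g ^ 2) := by
    rw [hsτ, hg]; field_simp
  simp only [e1, e2, e3] at h
  exact h

theorem norm_add_orthogonal_le {n : ℕ} {w b : EuclideanSpace ℝ (Fin n)} (hw : w ≠ 0)
    (hb : ‖b‖ = 1) (hwb : ⟪w, b⟫ = 0) (t : ℝ) :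
    ‖w + (2 * t) • b‖ ≤ ‖w‖ + 2 * t ^ 2 / ‖w‖ := by
  have hpos : 0 < ‖w‖ := norm_pos_iff.2 hw
  refine abs_le_of_sq_le_sq' ?_ (by positivity) |>.2
  rw [norm_add_sq_real, norm_smul, hb, inner_smul_right, hwb, mul_one, Real.norm_eq_abs, sq_abs]
  have : (‖w‖ + 2 * t ^ 2 / ‖w‖) ^ 2 = ‖w‖ ^ 2 + 4 * t ^ 2 + (2 * t ^ 2 / ‖w‖) ^ 2 := by
    field_simp
    ring
  rw [this]
  nlinarith [sq_nonneg (2 * t ^ 2 / ‖w‖)]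

/-- The two-point weight along antiparallel lines. -/
theorem twoPointDist_antiparallel {n : ℕ} (l t : ℝ) (x y b : EuclideanSpace ℝ (Fin n)) :
    twoPointDist l (x + t • b) (y + t • (-b)) =
      (l + ‖(x - y) + (2 * t) • b‖) / (1 - ‖(1 / 2 : ℝ) • (x + y)‖ ^ 2) := by
  rw [twoPointDist]
  congr 3
  · module
  · congr 2; module

theorem two_point_antiparallel {n : ℕ} {u v : EuclideanSpace ℝ (Fin n) → ℝ}
    (hu : ContDiff ℝ (⊤ : ℕ∞) u) (hv : ContDiff ℝ (⊤ : ℕ∞) v) (hu0 : ∀ x, 0 < u x)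
    (hv0 : ∀ x, 0 < v x) {x y b : EuclideanSpace ℝ (Fin n)} {k l s g κ : ℝ}
    (hmax : ∀ᶠ z in nhds (x, y), twoPointLog u v k l z.1 z.2 ≤ twoPointLog u v k l x y)
    (hD : 0 < 1 - ‖(1 / 2 : ℝ) • (x + y)‖ ^ 2)
    (hs : s = twoPointDist l x y) (hg : g = 1 / (1 - ‖(1 / 2 : ℝ) • (x + y)‖ ^ 2))
    (hF : 0 < s - k * s ^ 3) (hk : 0 ≤ k) (hκ : 3 * k * κ ^ 2 ≤ 1 / 2) (hsκ : s < κ) (hl : 0 < l)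
    {σ σ' : ℝ → ℝ} {σ2 : ℝ} (hσ : ∀ t, HasDerivAt σ (σ' t) t) (hσ' : HasDerivAt σ' σ2 0)
    (hσ0 : σ 0 = ‖x - y‖)
    (hσle : ∀ᶠ t in nhds (0 : ℝ), ‖(x - y) + (2 * t) • b‖ ≤ σ t) :
    fderiv ℝ u x b / u x - fderiv ℝ v y b / v y =
        2 * ((1 - 3 * k * s ^ 2) * (g * σ' 0) / (s - k * s ^ 3)) ∧
      dirTwo u b x / u x - (fderiv ℝ u x b / u x) ^ 2 +
          (dirTwo v b y / v y - (fderiv ℝ v y b / v y) ^ 2) ≤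
        2 * (((-(6 * k * s)) * (g * σ' 0) ^ 2 + (1 - 3 * k * s ^ 2) * (g * σ2)) / (s - k * s ^ 3) -
          ((1 - 3 * k * s ^ 2) * (g * σ' 0) / (s - k * s ^ 3)) ^ 2) := by
  have hg0 : 0 < g := by rw [hg]; positivity
  have hs0 : g * (l + σ 0) = s := by
    rw [hs, twoPointDist, hσ0, hg]
    ring
  have hcont : ContinuousAt (fun t => g * (l + σ t)) 0 := by
    have := (hσ 0).continuousAt
    fun_prop
  have hev1 : ∀ᶠ t in nhds (0 : ℝ), g * (l + σ t) < κ :=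
    hcont.eventually (gt_mem_nhds (by simpa only [hs0] using hsκ))
  have hspos : 0 < s := by
    rw [hs, twoPointDist]; positivity
  have h := two_point_line_test hu hv hu0 hv0 (x := x) (y := y) (p := b) (q := -b)
    (s := fun t => g * (l + σ t)) (s' := fun t => g * σ' t) (s2 := g * σ2) (k := k)
    (Filter.Eventually.of_forall fun t => ((hσ t).const_add l).const_mul g)
    (hσ'.const_mul g) (by simpa only [hs0] using hF)
    (by
      filter_upwards [(tendsto_two_lines x y b (-b)).eventually hmax, hσle, hev1] with t ht hle ht1
      simp only [twoPointLog, ← hs] at ht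
      set s1 := twoPointDist l (x + t • b) (y + t • (-b)) with hs1
      have hs1' : s1 = g * (l + ‖(x - y) + (2 * t) • b‖) := by
        rw [hs1, twoPointDist_antiparallel, hg]; ring
      have hs1pos : 0 < s1 := by rw [hs1']; positivity
      have hs1le : s1 ≤ g * (l + σ t) := by rw [hs1']; gcongr
      have hm := cubic_mono hk (by linarith : 3 * k * κ ^ 2 ≤ 1) hs1pos.le hs1le ht1.le
      have hp : 0 < s1 - k * s1 ^ 3 := by
        have h1 : k * s1 ^ 2 ≤ k * κ ^ 2 := by
          have : s1 ≤ κ := hs1le.trans ht1.le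
          gcongr
        nlinarith
      have hlog := Real.log_le_log hp hm
      simp only [hs0]
      linarith)
  simp only [hs0, dirTwo_neg, map_neg] at h
  refine ⟨by rw [← h.1]; ring, ?_⟩
  rw [neg_div, neg_sq] at h
  exact h.2

theorem two_point_arith_orthogonal {α β X Y s k g a F G : ℝ} (hs : 0 < s) (hF0 : 0 < F)
    (hG1 : G ≤ 1) (hg : 1 ≤ g) (ha : a ^ 2 ≤ 1) (hk : 0 ≤ k)
    (h1 : α + β = 2 * (G * (2 * a * g * s) / F)) (h2 : α - β = 0)
    (h3 : X - α ^ 2 + (Y - β ^ 2) ≤ 2 * (((-(6 * k * s)) * (2 * a * g * s) ^ 2 +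
      G * (s * (2 * g + 8 * a ^ 2 * g ^ 2))) / F - (G * (2 * a * g * s) / F) ^ 2)) :
    X + Y ≤ 20 * (s * g ^ 2 / F) := by
  have e1 : α = G * (2 * a * g * s) / F := by linarith
  have e2 : β = G * (2 * a * g * s) / F := by linarith
  rw [e1, e2] at h3
  have h4 : (-(6 * k * s)) * (2 * a * g * s) ^ 2 + G * (s * (2 * g + 8 * a ^ 2 * g ^ 2)) ≤
      10 * (s * g ^ 2) := by
    have t1 : 0 ≤ 6 * k * s * (2 * a * g * s) ^ 2 := by positivity
    have t2 : 2 * g + 8 * a ^ 2 * g ^ 2 ≤ 10 * g ^ 2 := by nlinarith [sq_nonneg g]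
    have t3 : G * (s * (2 * g + 8 * a ^ 2 * g ^ 2)) ≤ 1 * (s * (10 * g ^ 2)) := by
      gcongr
    linarith
  have h5 := div_le_div_of_nonneg_right h4 hF0.le
  have h6 : 10 * (s * g ^ 2) / F = 10 * (s * g ^ 2 / F) := by ring
  linarith

theorem two_point_arith_parallel {α β X Y s k g a F G : ℝ} (hs : 0 < s) (hF0 : 7 / 8 * s ≤ F)
    (hG0 : 0 ≤ G) (hG1 : G ≤ 1) (ha : a ^ 2 ≤ 1)
    (h1 : α + β = 2 * (G * (2 * a * g * s) / F)) (h2 : α - β = 2 * (G * (g * 2) / F))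
    (h3 : X - α ^ 2 + (Y - β ^ 2) ≤ 2 * (((-(6 * k * s)) * (g * 2) ^ 2 + G * (g * 0)) / F -
      (G * (g * 2) / F) ^ 2)) :
    X + Y ≤ (64 / 7 - 48 * k) * (s * g ^ 2 / F) := by
  have hFp : 0 < F := by linarith
  have e : α ^ 2 + β ^ 2 = 2 * (G * (2 * a * g * s) / F) ^ 2 + 2 * (G * (g * 2) / F) ^ 2 := by
    have : α ^ 2 + β ^ 2 = ((α + β) ^ 2 + (α - β) ^ 2) / 2 := by ring
    rw [this, h1, h2]; ring
  have h4 : (G * (2 * a * g * s) / F) ^ 2 ≤ 32 / 7 * (s * g ^ 2 / F) := by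
    have t1 : (G * (2 * a * g * s) / F) ^ 2 = (G ^ 2 * a ^ 2) * (4 * g ^ 2 * s) * (s / F) / F := by
      ring
    have t2 : s / F ≤ 8 / 7 := by rw [div_le_iff₀ hFp]; linarith
    have t3 : G ^ 2 * a ^ 2 ≤ 1 := by
      have : G ^ 2 ≤ 1 := by nlinarith
      nlinarith [sq_nonneg G, sq_nonneg a]
    rw [t1]
    calc (G ^ 2 * a ^ 2) * (4 * g ^ 2 * s) * (s / F) / F ≤ 1 * (4 * g ^ 2 * s) * (8 / 7) / F := by
          gcongr
      _ = _ := by ring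
  have h5 : ((-(6 * k * s)) * (g * 2) ^ 2 + G * (g * 0)) / F = -(24 * k) * (s * g ^ 2 / F) := by
    ring
  rw [h5] at h3
  linarith

theorem two_point_arith_diagonal {α β X Y s k g a F G : ℝ} (hs : 0 < s) (hF0 : 7 / 8 * s ≤ F)
    (hG1 : G ≤ 1) (hg : 1 ≤ g) (ha : a ^ 2 ≤ 1) (hk : 0 ≤ k)
    (h1 : α + β = 2 * (G * (2 * a * g * s) / F)) (h2 : |α - β| ≤ 2 * (G * (g * 2) / F))
    (h3 : X - α ^ 2 + (Y - β ^ 2) ≤ 2 * (((-(6 * k * s)) * (2 * a * g * s) ^ 2 +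
      G * (s * (2 * g + 8 * a ^ 2 * g ^ 2))) / F - (G * (2 * a * g * s) / F) ^ 2)) :
    X + Y ≤ (512 / 49) * (g / s) ^ 2 + 160 / 7 * g ^ 2 := by
  have hFp : 0 < F := by linarith
  have e : α ^ 2 + β ^ 2 = 2 * (G * (2 * a * g * s) / F) ^ 2 + (α - β) ^ 2 / 2 := by
    have : α ^ 2 + β ^ 2 = ((α + β) ^ 2 + (α - β) ^ 2) / 2 := by ring
    rw [this, h1]; ring
  have h4 : (α - β) ^ 2 ≤ 1024 / 49 * (g / s) ^ 2 := by
    have t0 : G * (g * 2) / F ≤ 1 * (g * 2) / (7 / 8 * s) := by gcongr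
    have t1 : |α - β| ≤ 32 / 7 * (g / s) := by
      refine h2.trans ?_
      calc _ ≤ 2 * (1 * (g * 2) / (7 / 8 * s)) := by gcongr
        _ = _ := by field_simp; ring
    rw [← sq_abs]
    calc _ ≤ (32 / 7 * (g / s)) ^ 2 := by gcongr
      _ = _ := by ring
  have h5 : ((-(6 * k * s)) * (2 * a * g * s) ^ 2 + G * (s * (2 * g + 8 * a ^ 2 * g ^ 2))) / F ≤
      80 / 7 * g ^ 2 := by
    have t1 : 0 ≤ 6 * k * s * (2 * a * g * s) ^ 2 := by positivity
    have t2 : 2 * g + 8 * a ^ 2 * g ^ 2 ≤ 10 * g ^ 2 := by nlinarith [sq_nonneg g]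
    have t3 : G * (s * (2 * g + 8 * a ^ 2 * g ^ 2)) ≤ 1 * (s * (10 * g ^ 2)) := by
      gcongr
    rw [div_le_iff₀ hFp]
    have t4 : 80 / 7 * g ^ 2 * (7 / 8 * s) ≤ 80 / 7 * g ^ 2 * F := by gcongr
    linarith
  linarith

theorem orthonormalBasis_with_vector {n : ℕ} {e : EuclideanSpace ℝ (Fin n)} (he : ‖e‖ = 1) :
    ∃ (b : OrthonormalBasis (Fin n) ℝ (EuclideanSpace ℝ (Fin n))) (i : Fin n), b i = e := by
  have hn : 0 < n := by
    rcases Nat.eq_zero_or_pos n with h | h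
    · subst h
      have : e = 0 := Subsingleton.elim _ _
      simp [this] at he
    · exact h
  obtain ⟨b, hb⟩ := Orthonormal.exists_orthonormalBasis_extension_of_card_eq (𝕜 := ℝ)
    (ι := Fin n) (E := EuclideanSpace ℝ (Fin n)) (by simp) (v := fun _ => e) (s := {⟨0, hn⟩})
    (by
      refine ⟨fun _ => he, fun i j hij => ?_⟩
      exact absurd (Subsingleton.elim i j) hij)
  exact ⟨b, ⟨0, hn⟩, hb _ rfl⟩

/-- Bounds on the cubic weight and its derivative on the range of the two-point distance. -/
theorem cubic_bounds {n : ℕ} (hn : 2 ≤ n) {s : ℝ} (hs : 0 < s) (hsκ : s ≤ 1 / (2 * n)) :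
    7 / 8 * s ≤ s - n * s ^ 3 ∧ 0 ≤ 1 - 3 * n * s ^ 2 ∧ 1 - 3 * n * s ^ 2 ≤ 1 := by
  have hn' : (2 : ℝ) ≤ n := by exact_mod_cast hn
  have h1 : n * s ≤ 1 / 2 := by
    rw [le_div_iff₀ (by positivity)] at hsκ
    linarith
  have h2 : s ≤ 1 / 4 := by nlinarith
  have h3 : n * s ^ 2 ≤ 1 / 8 := by nlinarith
  have h4 : 0 ≤ n * s ^ 2 := by positivity
  exact ⟨by nlinarith, by linarith, by linarith⟩

theorem cubic_kappa {n : ℕ} (hn : 2 ≤ n) : 3 * (n : ℝ) * (1 / (2 * n)) ^ 2 ≤ 1 / 2 := by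
  have hn' : (2 : ℝ) ≤ n := by exact_mod_cast hn
  have : 3 * (n : ℝ) * (1 / (2 * n)) ^ 2 = 3 / (4 * n) := by field_simp; ring
  rw [this, div_le_div_iff₀ (by positivity) (by norm_num)]
  linarith

theorem inner_sq_le_one {n : ℕ} {c b : EuclideanSpace ℝ (Fin n)} (hc : 0 < 1 - ‖c‖ ^ 2)
    (hb : ‖b‖ = 1) : ⟪c, b⟫ ^ 2 ≤ 1 := by
  have := abs_real_inner_le_norm c b
  rw [hb, mul_one] at this
  rw [← sq_abs]
  nlinarith [abs_nonneg ⟪c, b⟫]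

theorem one_le_inv_weight {n : ℕ} {c : EuclideanSpace ℝ (Fin n)} (hc : 0 < 1 - ‖c‖ ^ 2) :
    1 ≤ 1 / (1 - ‖c‖ ^ 2) := by
  rw [le_div_iff₀ hc]
  nlinarith [sq_nonneg ‖c‖]

/-- No interior local maximum of the two-point quotient off the diagonal. -/
theorem two_point_off_diagonal {n : ℕ} (hn : 2 ≤ n) {u v : EuclideanSpace ℝ (Fin n) → ℝ}
    (hsol : IsSolution u v) {x y : EuclideanSpace ℝ (Fin n)} {l : ℝ} (hl : 0 < l) (hxy : x ≠ y)
    (hmax : ∀ᶠ z in nhds (x, y), twoPointLog u v n l z.1 z.2 ≤ twoPointLog u v n l x y)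
    (hD : 0 < 1 - ‖(1 / 2 : ℝ) • (x + y)‖ ^ 2) (hsκ : twoPointDist l x y < 1 / (2 * n)) :
    False := by
  obtain ⟨hu, hv, hu0, hv0, hlu, hlv⟩ := hsol
  obtain ⟨s, hs⟩ : ∃ s, s = twoPointDist l x y := ⟨_, rfl⟩
  obtain ⟨g, hg⟩ : ∃ g, g = 1 / (1 - ‖(1 / 2 : ℝ) • (x + y)‖ ^ 2) := ⟨_, rfl⟩
  rw [← hs] at hsκ
  have hn' : (2 : ℝ) ≤ n := by exact_mod_cast hn
  have hspos : 0 < s := by rw [hs, twoPointDist]; positivity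
  obtain ⟨hF, hG0, hG1⟩ := cubic_bounds hn hspos hsκ.le
  have hFp : 0 < s - n * s ^ 3 := by linarith
  have hg1 : 1 ≤ g := by rw [hg]; exact one_le_inv_weight hD
  have hr : 0 < ‖x - y‖ := norm_pos_iff.2 (sub_ne_zero.2 hxy)
  obtain ⟨b, i0, hb0⟩ := orthonormalBasis_with_vector (e := (‖x - y‖)⁻¹ • (x - y))
    (by rw [norm_smul, norm_inv, norm_norm, inv_mul_cancel₀ hr.ne'])
  have hxyb : x - y = ‖x - y‖ • b i0 := by
    rw [hb0, smul_smul, mul_inv_cancel₀ hr.ne', one_smul]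
  have hpar := fun i => two_point_parallel hu hv hu0 hv0 hmax (b.norm_eq_one i) hD hs hg rfl hFp
  have hother : ∀ i, i ≠ i0 →
      dirTwo u (b i) x / u x + dirTwo v (b i) y / v y ≤ 20 * (s * g ^ 2 / (s - n * s ^ 3)) := by
    intro i hi
    have horth : ⟪x - y, b i⟫ = 0 := by
      rw [hxyb, inner_smul_left, b.orthonormal.2 hi.symm, mul_zero]
    have hanti := two_point_antiparallel hu hv hu0 hv0 hmax hD hs hg hFp (by positivity)
      (cubic_kappa hn) hsκ hl (b := b i) (σ := fun t => ‖x - y‖ + 2 * t ^ 2 / ‖x - y‖)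
      (σ' := fun t => 4 * t / ‖x - y‖) (σ2 := 4 / ‖x - y‖)
      (fun t => by
        refine ((((hasDerivAt_pow 2 t).const_mul 2).div_const _).const_add _).congr_deriv ?_
        push_cast; ring)
      (by
        refine (((hasDerivAt_id (0 : ℝ)).const_mul 4).div_const _).congr_deriv ?_
        ring)
      (by simp)
      (Filter.Eventually.of_forall fun t =>
        norm_add_orthogonal_le (sub_ne_zero.2 hxy) (b.norm_eq_one i) horth t)
    exact two_point_arith_orthogonal hspos hFp hG1 hg1
      (inner_sq_le_one hD (b.norm_eq_one i)) (by positivity) (hpar i).1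
      (by rw [hanti.1]; simp) (hpar i).2
  have hmain : dirTwo u (b i0) x / u x + dirTwo v (b i0) y / v y ≤
      (64 / 7 - 48 * n) * (s * g ^ 2 / (s - n * s ^ 3)) := by
    have hanti := two_point_antiparallel hu hv hu0 hv0 hmax hD hs hg hFp (by positivity)
      (cubic_kappa hn) hsκ hl (b := b i0) (σ := fun t => ‖x - y‖ + 2 * t)
      (σ' := fun _ => 2) (σ2 := 0)
      (fun t => by
        refine (((hasDerivAt_id t).const_mul 2).const_add _).congr_deriv ?_
        ring)
      (hasDerivAt_const _ _)
      (by simp)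
      (by
        have : ∀ᶠ t in nhds (0 : ℝ), 0 < ‖x - y‖ + 2 * t := by
          have hc : ContinuousAt (fun t : ℝ => ‖x - y‖ + 2 * t) 0 := by fun_prop
          exact hc.eventually (lt_mem_nhds (by simpa using hr))
        filter_upwards [this] with t ht
        have e : (x - y) + (2 * t) • b i0 = (‖x - y‖ + 2 * t) • b i0 := by
          rw [add_smul, ← hxyb]
        rw [e, norm_smul, b.norm_eq_one, mul_one, Real.norm_eq_abs, abs_of_pos ht])
    exact two_point_arith_parallel hspos hF hG0 hG1
      (inner_sq_le_one hD (b.norm_eq_one i0)) (hpar i0).1 hanti.1 hanti.2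
  have hsum : ∑ i, (dirTwo u (b i) x / u x + dirTwo v (b i) y / v y) = v x ^ 2 + u y ^ 2 := by
    rw [Finset.sum_add_distrib, ← Finset.sum_div, ← Finset.sum_div, ← lap_eq_sum_dirTwo hu,
      ← lap_eq_sum_dirTwo hv, hlu, hlv, mul_div_cancel_left₀ _ (hu0 x).ne',
      mul_div_cancel_left₀ _ (hv0 y).ne']
  rw [← Finset.add_sum_erase _ _ (Finset.mem_univ i0)] at hsum
  have hrest := Finset.sum_le_card_nsmul (Finset.univ.erase i0) _ _
    (fun i hi => hother i (Finset.ne_of_mem_erase hi))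
  rw [Finset.card_erase_of_mem (Finset.mem_univ i0), Finset.card_univ, Fintype.card_fin,
    nsmul_eq_mul, Nat.cast_sub (by omega)] at hrest
  have hq : 0 < s * g ^ 2 / (s - n * s ^ 3) := by positivity
  have := pow_pos (hv0 x) 2
  have := pow_pos (hu0 y) 2
  push_cast at hrest
  nlinarith [mul_pos (show (0 : ℝ) < 28 * n + 20 - 64 / 7 by linarith) hq]

/-- At an interior local maximum of the two-point quotient on the diagonal, the two components
are controlled. -/
theorem two_point_diagonal {n : ℕ} (hn : 2 ≤ n) {u v : EuclideanSpace ℝ (Fin n) → ℝ}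
    (hsol : IsSolution u v) {x : EuclideanSpace ℝ (Fin n)} {l : ℝ} (hl : 0 < l)
    (hmax : ∀ᶠ z in nhds (x, x), twoPointLog u v n l z.1 z.2 ≤ twoPointLog u v n l x x)
    (hD : 0 < 1 - ‖(1 / 2 : ℝ) • (x + x)‖ ^ 2) (hsκ : twoPointDist l x x < 1 / (2 * n)) :
    u x * v x ≤ 6 * n / l ^ 2 := by
  obtain ⟨hu, hv, hu0, hv0, hlu, hlv⟩ := hsol
  obtain ⟨s, hs⟩ : ∃ s, s = twoPointDist l x x := ⟨_, rfl⟩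
  obtain ⟨g, hg⟩ : ∃ g, g = 1 / (1 - ‖(1 / 2 : ℝ) • (x + x)‖ ^ 2) := ⟨_, rfl⟩
  rw [← hs] at hsκ
  have hn' : (2 : ℝ) ≤ n := by exact_mod_cast hn
  have hspos : 0 < s := by rw [hs, twoPointDist]; positivity
  have hsg : s = g * l := by rw [hs, hg, twoPointDist]; simp; ring
  obtain ⟨hF, hG0, hG1⟩ := cubic_bounds hn hspos hsκ.le
  have hFp : 0 < s - n * s ^ 3 := by linarith
  have hg1 : 1 ≤ g := by rw [hg]; exact one_le_inv_weight hD
  let b := EuclideanSpace.basisFun (Fin n) ℝ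
  have hpar := fun i => two_point_parallel hu hv hu0 hv0 hmax (b.norm_eq_one i) hD hs hg rfl hFp
  have hone : ∀ p : EuclideanSpace ℝ (Fin n), ‖p‖ = 1 →
      fderiv ℝ u x p / u x - fderiv ℝ v x p / v x ≤
        2 * ((1 - 3 * n * s ^ 2) * (g * 2) / (s - n * s ^ 3)) := by
    intro p hp
    have hlin : ∀ t, HasDerivAt (fun t : ℝ => g * (l + 2 * t)) (g * 2) t := fun t => by
      refine ((((hasDerivAt_id t).const_mul 2).const_add l).const_mul g).congr_deriv ?_
      ring
    have hs0 : g * (l + 2 * 0) = s := by rw [hsg]; ring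
    have hd1 := (hasDerivAt_line (hu.differentiable (by simp)) x p 0).log (hu0 _).ne'
    have hd2 := (hasDerivAt_line (hv.differentiable (by simp)) x (-p) 0).log (hv0 _).ne'
    have hd3 : HasDerivAt (fun t : ℝ => g * (l + 2 * t) - n * (g * (l + 2 * t)) ^ 3)
        ((1 - 3 * n * s ^ 2) * (g * 2)) 0 := by
      refine ((hlin 0).sub (((hlin 0).pow 3).const_mul (n : ℝ))).congr_deriv ?_
      rw [hs0]
      push_cast
      ring
    have hd := (hd1.add hd2).sub ((hd3.log (by rw [hs0]; exact hFp.ne')).const_mul 2)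
    have := one_sided_derivative_test hd (by
      filter_upwards [(tendsto_two_lines x x p (-p)).eventually hmax] with t ht htp
      have e : twoPointDist l (x + t • p) (x + t • (-p)) = g * (l + 2 * t) := by
        rw [twoPointDist_antiparallel, sub_self, zero_add, norm_smul, hp, Real.norm_eq_abs,
          abs_of_pos (by linarith), hg]
        ring
      simp only [twoPointLog, e, ← hs] at ht
      simpa [hs0, ← hsg] using ht)
    simp only [zero_smul, add_zero, map_neg, neg_div] at this
    rw [show g * (l + 2 * 0) = s from hs0] at this
    linarith
  have hbound : ∀ i, dirTwo u (b i) x / u x + dirTwo v (b i) x / v x ≤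
      (512 / 49) * (g / s) ^ 2 + 160 / 7 * g ^ 2 := by
    intro i
    refine two_point_arith_diagonal hspos hF hG1 hg1 (inner_sq_le_one hD (b.norm_eq_one i))
      (by positivity) (hpar i).1 ?_ (hpar i).2
    refine abs_le.2 ⟨?_, hone _ (b.norm_eq_one i)⟩
    have := hone (-(b i)) (by rw [norm_neg]; exact b.norm_eq_one i)
    simp only [map_neg, neg_div] at this
    linarith
  have hsum : ∑ i, (dirTwo u (b i) x / u x + dirTwo v (b i) x / v x) = v x ^ 2 + u x ^ 2 := by
    rw [Finset.sum_add_distrib, ← Finset.sum_div, ← Finset.sum_div, ← lap_eq_sum_dirTwo hu,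
      ← lap_eq_sum_dirTwo hv, hlu, hlv, mul_div_cancel_left₀ _ (hu0 x).ne',
      mul_div_cancel_left₀ _ (hv0 x).ne']
  have hle := Finset.sum_le_card_nsmul Finset.univ _ _ (fun i _ => hbound i)
  rw [hsum, Finset.card_univ, Fintype.card_fin, nsmul_eq_mul] at hle
  have e1 : (g / s) ^ 2 = 1 / l ^ 2 := by rw [hsg]; field_simp
  have e2 : g ^ 2 ≤ 1 / 16 * (1 / l ^ 2) := by
    have h1 : s ≤ 1 / 4 := by
      refine hsκ.le.trans ?_
      rw [div_le_div_iff₀ (by positivity) (by norm_num)]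
      linarith
    have h2 : g = s / l := by rw [hsg]; field_simp
    rw [h2, div_pow]
    have : s ^ 2 ≤ 1 / 16 := by nlinarith
    rw [div_le_iff₀ (by positivity)]
    calc s ^ 2 ≤ 1 / 16 := this
      _ = _ := by field_simp
  rw [e1] at hle
  have e3 : (n : ℝ) * (512 / 49 * (1 / l ^ 2) + 160 / 7 * g ^ 2) ≤ n * (12 * (1 / l ^ 2)) := by
    gcongr
    have : 0 < 1 / l ^ 2 := by positivity
    linarith
  have e4 : 6 * n / l ^ 2 = n * (12 * (1 / l ^ 2)) / 2 := by ring
  rw [e4]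
  nlinarith [sq_nonneg (u x - v x)]

theorem twoPointDist_pos {n : ℕ} {l : ℝ} (hl : 0 < l) {x y : EuclideanSpace ℝ (Fin n)}
    (hD : 0 < 1 - ‖(1 / 2 : ℝ) • (x + y)‖ ^ 2) : 0 < twoPointDist l x y := by
  rw [twoPointDist]; positivity

theorem continuousAt_twoPointDist {n : ℕ} {l : ℝ}
    {z : EuclideanSpace ℝ (Fin n) × EuclideanSpace ℝ (Fin n)}
    (hD : 0 < 1 - ‖(1 / 2 : ℝ) • (z.1 + z.2)‖ ^ 2) :
    ContinuousAt (fun p : EuclideanSpace ℝ (Fin n) × EuclideanSpace ℝ (Fin n) =>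
      twoPointDist l p.1 p.2) z := by
  unfold twoPointDist
  exact ContinuousAt.div (by fun_prop) (by fun_prop) hD.ne'

theorem two_point_compact {n : ℕ} (hn : 2 ≤ n) {u v : EuclideanSpace ℝ (Fin n) → ℝ}
    (hsol : IsSolution u v) {l S : ℝ} (hl : 0 < l)
    (hS : ∀ y z : EuclideanSpace ℝ (Fin n), ‖y‖ ≤ 2 → ‖z‖ ≤ 2 → u y * v z ≤ S)
    {x y : EuclideanSpace ℝ (Fin n)} (hD : 0 < 1 - ‖(1 / 2 : ℝ) • (x + y)‖ ^ 2)
    (hs : twoPointDist l x y ≤ 1 / (2 * n)) :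
    u x * v y ≤ (6 * n ^ 2 * S + 8 * n / l ^ 4) * twoPointDist l x y ^ 2 := by
  have hsol' := hsol
  obtain ⟨hu, hv, hu0, hv0, -, -⟩ := hsol'
  have hn' : (2 : ℝ) ≤ n := by exact_mod_cast hn
  set κ : ℝ := 1 / (2 * n) with hκ
  have hκ0 : 0 < κ := by positivity
  have hκ4 : κ ≤ 1 / 4 := by
    rw [hκ, div_le_div_iff₀ (by positivity) (by norm_num)]; linarith
  have hS0 : 0 ≤ S := (mul_pos (hu0 0) (hv0 0)).le.trans (hS 0 0 (by simp) (by simp))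
  set K : Set (EuclideanSpace ℝ (Fin n) × EuclideanSpace ℝ (Fin n)) :=
    {p | ‖(1 / 2 : ℝ) • (p.1 + p.2)‖ ≤ 1 ∧
      l + ‖p.1 - p.2‖ ≤ κ * (1 - ‖(1 / 2 : ℝ) • (p.1 + p.2)‖ ^ 2)} with hK
  have hKmem : ∀ p : EuclideanSpace ℝ (Fin n) × EuclideanSpace ℝ (Fin n),
      p ∈ K ↔ 0 < 1 - ‖(1 / 2 : ℝ) • (p.1 + p.2)‖ ^ 2 ∧ twoPointDist l p.1 p.2 ≤ κ := by
    intro p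
    constructor
    · rintro ⟨-, h2⟩
      have hpos : 0 < 1 - ‖(1 / 2 : ℝ) • (p.1 + p.2)‖ ^ 2 :=
        pos_of_mul_pos_right ((by positivity : 0 < l + ‖p.1 - p.2‖).trans_le h2) hκ0.le
      exact ⟨hpos, by rw [twoPointDist, div_le_iff₀ hpos]; exact h2⟩
    · rintro ⟨h1, h2⟩
      refine ⟨by nlinarith [norm_nonneg ((1 / 2 : ℝ) • (p.1 + p.2))], ?_⟩
      rwa [twoPointDist, div_le_iff₀ h1] at h2
  have hKnorm : ∀ p ∈ K, ‖p.1‖ ≤ 2 ∧ ‖p.2‖ ≤ 2 := by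
    rintro p ⟨h1, h2⟩
    have h3 : ‖p.1 - p.2‖ ≤ 1 / 4 := by
      nlinarith [sq_nonneg ‖(1 / 2 : ℝ) • (p.1 + p.2)‖]
    have h4 : ‖(1 / 2 : ℝ) • (p.1 - p.2)‖ ≤ 1 / 4 := by
      rw [norm_smul]; norm_num; linarith
    constructor
    · calc ‖p.1‖ = ‖(1 / 2 : ℝ) • (p.1 + p.2) + (1 / 2 : ℝ) • (p.1 - p.2)‖ := by
            congr 1; module
        _ ≤ _ := norm_add_le _ _
        _ ≤ 2 := by linarith
    · calc ‖p.2‖ = ‖(1 / 2 : ℝ) • (p.1 + p.2) - (1 / 2 : ℝ) • (p.1 - p.2)‖ := by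
            congr 1; module
        _ ≤ _ := norm_sub_le _ _
        _ ≤ 2 := by linarith
  have hKc : IsCompact K := by
    refine Metric.isCompact_of_isClosed_isBounded ?_ ?_
    · have c1 : Continuous fun p : EuclideanSpace ℝ (Fin n) × EuclideanSpace ℝ (Fin n) =>
          ‖(1 / 2 : ℝ) • (p.1 + p.2)‖ := by fun_prop
      have c2 : Continuous fun p : EuclideanSpace ℝ (Fin n) × EuclideanSpace ℝ (Fin n) =>
          l + ‖p.1 - p.2‖ := by fun_prop
      exact (isClosed_le c1 continuous_const).inter
        (isClosed_le c2 (continuous_const.mul (continuous_const.sub (c1.pow 2))))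
    · refine (Metric.isBounded_closedBall (x := 0) (r := 2)).subset ?_
      intro p hp
      rw [mem_closedBall_zero_iff, Prod.norm_def]
      exact max_le (hKnorm p hp).1 (hKnorm p hp).2
  have hFpos : ∀ p ∈ K, 7 / 8 * twoPointDist l p.1 p.2 ≤
      twoPointDist l p.1 p.2 - n * twoPointDist l p.1 p.2 ^ 3 ∧ 0 < twoPointDist l p.1 p.2 := by
    intro p hp
    have h := (hKmem p).1 hp
    have h0 := twoPointDist_pos hl h.1
    exact ⟨(cubic_bounds hn h0 h.2).1, h0⟩
  have hcont : ContinuousOn (fun p : EuclideanSpace ℝ (Fin n) × EuclideanSpace ℝ (Fin n) =>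
      twoPointLog u v n l p.1 p.2) K := by
    intro p hp
    refine ContinuousAt.continuousWithinAt ?_
    have hc := continuousAt_twoPointDist (l := l) ((hKmem p).1 hp).1
    have h := hFpos p hp
    unfold twoPointLog
    refine ContinuousAt.sub (ContinuousAt.add ?_ ?_) ?_
    · exact ((hu.continuous.comp continuous_fst).continuousAt).log (hu0 _).ne'
    · exact ((hv.continuous.comp continuous_snd).continuousAt).log (hv0 _).ne'
    · refine continuousAt_const.mul (ContinuousAt.log ?_ (by linarith))
      exact hc.sub (continuousAt_const.mul (hc.pow 3))
  have hxyK : (x, y) ∈ K := (hKmem _).2 ⟨hD, hs⟩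
  obtain ⟨⟨x', y'⟩, hzK, hzmax⟩ := hKc.exists_isMaxOn ⟨_, hxyK⟩ hcont
  set M := 6 * n ^ 2 * S + 8 * n / l ^ 4 with hM
  have hM0 : 0 < M := by positivity
  have hz := (hKmem _).1 hzK
  have hzF := hFpos _ hzK
  simp only at hz hzF
  have hstar : u x' * v y' ≤
      M * (twoPointDist l x' y' - n * twoPointDist l x' y' ^ 3) ^ 2 := by
    set s := twoPointDist l x' y' with hs'
    have hF2 : (7 / 8 * s) ^ 2 ≤ (s - n * s ^ 3) ^ 2 := by
      have := hzF.2
      gcongr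
      exact hzF.1
    rcases hz.2.lt_or_eq with hlt | heq
    · have hloc : ∀ᶠ z in nhds (x', y'),
          twoPointLog u v n l z.1 z.2 ≤ twoPointLog u v n l x' y' := by
        have h1 : ∀ᶠ z : EuclideanSpace ℝ (Fin n) × EuclideanSpace ℝ (Fin n) in nhds (x', y'),
            0 < 1 - ‖(1 / 2 : ℝ) • (z.1 + z.2)‖ ^ 2 := by
          have hc : ContinuousAt (fun z : EuclideanSpace ℝ (Fin n) × EuclideanSpace ℝ (Fin n) =>
            1 - ‖(1 / 2 : ℝ) • (z.1 + z.2)‖ ^ 2) (x', y') := by fun_prop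
          exact hc.eventually (lt_mem_nhds hz.1)
        have h2 : ∀ᶠ z : EuclideanSpace ℝ (Fin n) × EuclideanSpace ℝ (Fin n) in nhds (x', y'),
            twoPointDist l z.1 z.2 < κ :=
          (continuousAt_twoPointDist (z := (x', y')) hz.1).eventually (gt_mem_nhds hlt)
        filter_upwards [h1, h2] with z hz1 hz2
        exact hzmax ((hKmem z).2 ⟨hz1, hz2.le⟩)
      by_cases hxy : x' = y'
      · subst hxy
        have hdiag := two_point_diagonal hn hsol hl hloc hz.1 hlt
        have hls : l ≤ s := by
          rw [hs', twoPointDist, le_div_iff₀ hz.1, sub_self, norm_zero, add_zero]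
          nlinarith [sq_nonneg ‖(1 / 2 : ℝ) • (x' + x')‖]
        have h49 : (7 / 8 * l) ^ 2 ≤ (s - n * s ^ 3) ^ 2 := le_trans (by gcongr) hF2
        calc u x' * v x' ≤ 6 * n / l ^ 2 := hdiag
          _ ≤ (49 / 8) * n / l ^ 2 := by gcongr; norm_num
          _ = 8 * n / l ^ 4 * (7 / 8 * l) ^ 2 := by field_simp; ring
          _ ≤ M * (s - n * s ^ 3) ^ 2 := by
            gcongr
            rw [hM]
            have : 0 ≤ 6 * (n : ℝ) ^ 2 * S := by positivity
            linarith
      · exact (two_point_off_diagonal hn hsol hl hxy hloc hz.1 hlt).elim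
    · have h1 := hS x' y' (hKnorm _ hzK).1 (hKnorm _ hzK).2
      have h49 : (7 / 8 * κ) ^ 2 ≤ (s - n * s ^ 3) ^ 2 := by rw [← heq]; exact hF2
      calc u x' * v y' ≤ S := h1
        _ ≤ 147 / 128 * S := by linarith
        _ = 6 * n ^ 2 * S * (7 / 8 * κ) ^ 2 := by rw [hκ]; field_simp; ring
        _ ≤ M * (s - n * s ^ 3) ^ 2 := by
          gcongr
          rw [hM]
          have : 0 ≤ 8 * (n : ℝ) / l ^ 4 := by positivity
          linarith
  have hmx : twoPointLog u v n l x y ≤ twoPointLog u v n l x' y' := hzmax hxyK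
  have hxF := hFpos _ hxyK
  simp only [twoPointLog] at hmx hxF
  set s := twoPointDist l x y
  set s' := twoPointDist l x' y'
  have hF' : 0 < s' - n * s' ^ 3 := by linarith
  have hF : 0 < s - n * s ^ 3 := by linarith
  have hlogstar := Real.log_le_log (mul_pos (hu0 x') (hv0 y')) hstar
  rw [Real.log_mul (hu0 _).ne' (hv0 _).ne', Real.log_mul hM0.ne' (by positivity),
    Real.log_pow] at hlogstar
  have hfin : Real.log (u x * v y) ≤ Real.log (M * (s - n * s ^ 3) ^ 2) := by
    rw [Real.log_mul (hu0 _).ne' (hv0 _).ne', Real.log_mul hM0.ne' (by positivity), Real.log_pow]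
    push_cast at hlogstar ⊢
    linarith
  rw [Real.log_le_log_iff (mul_pos (hu0 x) (hv0 y)) (by positivity)] at hfin
  refine hfin.trans ?_
  gcongr
  have := hxF.2
  have : 0 ≤ n * s ^ 3 := by positivity
  linarith

theorem two_point_unit {n : ℕ} (hn : 2 ≤ n) {u v : EuclideanSpace ℝ (Fin n) → ℝ}
    (hsol : IsSolution u v) {l S : ℝ} (hl : 0 < l)
    (hS : ∀ y z : EuclideanSpace ℝ (Fin n), ‖y‖ ≤ 2 → ‖z‖ ≤ 2 → u y * v z ≤ S)
    {x y : EuclideanSpace ℝ (Fin n)} (hx : ‖x‖ ≤ 1 / 2) (hy : ‖y‖ ≤ 1 / 2) :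
    u x * v y ≤ 15 * n ^ 2 * (S + 1 / l ^ 4) * (l + ‖x - y‖) ^ 2 := by
  have hn' : (2 : ℝ) ≤ n := by exact_mod_cast hn
  have hS0 : 0 ≤ S :=
    (mul_pos (hsol.2.2.1 0) (hsol.2.2.2.1 0)).le.trans (hS 0 0 (by simp) (by simp))
  have hc : ‖(1 / 2 : ℝ) • (x + y)‖ ≤ 1 / 2 := by
    rw [norm_smul, Real.norm_eq_abs, abs_of_pos (by norm_num)]
    linarith [norm_add_le x y]
  have hD : 3 / 4 ≤ 1 - ‖(1 / 2 : ℝ) • (x + y)‖ ^ 2 := by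
    nlinarith [norm_nonneg ((1 / 2 : ℝ) • (x + y))]
  have hD0 : 0 < 1 - ‖(1 / 2 : ℝ) • (x + y)‖ ^ 2 := by linarith
  set τ := l + ‖x - y‖ with hτ
  have hτ0 : 0 < τ := by positivity
  rcases le_or_gt (twoPointDist l x y) (1 / (2 * n)) with h | h
  · refine (two_point_compact hn hsol hl hS hD0 h).trans ?_
    have h1 : twoPointDist l x y ≤ 4 / 3 * τ := by
      rw [twoPointDist, div_le_iff₀ hD0]
      nlinarith
    have h0 := (twoPointDist_pos hl hD0).le
    calc (6 * n ^ 2 * S + 8 * n / l ^ 4) * twoPointDist l x y ^ 2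
        ≤ (6 * n ^ 2 * S + 4 * n ^ 2 / l ^ 4) * (4 / 3 * τ) ^ 2 := by
          have h8 : 8 * (n : ℝ) ≤ 4 * n ^ 2 := by nlinarith
          have h9 := div_le_div_of_nonneg_right h8 (by positivity : (0 : ℝ) ≤ l ^ 4)
          gcongr
      _ = (32 / 3 * n ^ 2 * S + 64 / 9 * n ^ 2 * (1 / l ^ 4)) * τ ^ 2 := by ring
      _ ≤ (15 * n ^ 2 * S + 15 * n ^ 2 * (1 / l ^ 4)) * τ ^ 2 := by
          gcongr <;> norm_num
      _ = _ := by ring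
  · have h1 : 3 / 8 ≤ n * τ := by
      rw [twoPointDist, ← hτ, lt_div_iff₀ hD0, div_mul_eq_mul_div, one_mul,
        div_lt_iff₀ (by positivity)] at h
      linarith
    have h2 := hS x y (by linarith) (by linarith)
    have h3 : (3 / 8 : ℝ) ^ 2 ≤ (n * τ) ^ 2 := by gcongr
    have h4 : 0 ≤ 15 * (n : ℝ) ^ 2 * (1 / l ^ 4) * τ ^ 2 := by positivity
    nlinarith [mul_le_mul_of_nonneg_left h3 hS0]

theorem dirTwo_scale {n : ℕ} {u : EuclideanSpace ℝ (Fin n) → ℝ} (hu : ContDiff ℝ (⊤ : ℕ∞) u)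
    (x p y : EuclideanSpace ℝ (Fin n)) (ρ : ℝ) :
    dirTwo (fun z => ρ * u (x + ρ • z)) p y = ρ ^ 3 * dirTwo u p (x + ρ • y) := by
  have haff : ∀ y : EuclideanSpace ℝ (Fin n), HasFDerivAt (fun z => x + ρ • z)
      (ρ • ContinuousLinearMap.id ℝ (EuclideanSpace ℝ (Fin n))) y := fun y =>
    ((hasFDerivAt_id y).const_smul ρ).const_add x
  have h1 : ∀ f : EuclideanSpace ℝ (Fin n) → ℝ, Differentiable ℝ f → ∀ (c : ℝ) y,
      fderiv ℝ (fun z => c * f (x + ρ • z)) y p = c * ρ * fderiv ℝ f (x + ρ • y) p := by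
    intro f hf c y
    have := ((hf (x + ρ • y)).hasFDerivAt.comp y (haff y)).const_mul c
    rw [show (fun z => c * f (x + ρ • z)) = fun z => c * (f ∘ fun z => x + ρ • z) z from rfl,
      this.fderiv]
    simp
    ring
  rw [dirTwo, funext (h1 u (hu.differentiable (by simp)) ρ),
    h1 _ ((contDiff_fderiv_apply hu p).differentiable (by simp)), dirTwo]
  ring

theorem IsSolution.scale {n : ℕ} {u v : EuclideanSpace ℝ (Fin n) → ℝ} (hsol : IsSolution u v)
    (x : EuclideanSpace ℝ (Fin n)) {ρ : ℝ} (hρ : 0 < ρ) :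
    IsSolution (fun z => ρ * u (x + ρ • z)) (fun z => ρ * v (x + ρ • z)) := by
  obtain ⟨hu, hv, hu0, hv0, hlu, hlv⟩ := hsol
  have hsm : ∀ f : EuclideanSpace ℝ (Fin n) → ℝ, ContDiff ℝ (⊤ : ℕ∞) f →
      ContDiff ℝ (⊤ : ℕ∞) (fun z => ρ * f (x + ρ • z)) := fun f hf =>
    contDiff_const.mul (hf.comp (by fun_prop))
  have hlap : ∀ f : EuclideanSpace ℝ (Fin n) → ℝ, ContDiff ℝ (⊤ : ℕ∞) f → ∀ y,
      lap (fun z => ρ * f (x + ρ • z)) y = ρ ^ 3 * lap f (x + ρ • y) := by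
    intro f hf y
    rw [lap_eq_sum_dirTwo (hsm f hf) (EuclideanSpace.basisFun (Fin n) ℝ),
      lap_eq_sum_dirTwo hf (EuclideanSpace.basisFun (Fin n) ℝ), Finset.mul_sum]
    exact Finset.sum_congr rfl fun i _ => dirTwo_scale hf _ _ _ _
  refine ⟨hsm u hu, hsm v hv, fun y => mul_pos hρ (hu0 _), fun y => mul_pos hρ (hv0 _),
    fun y => ?_, fun y => ?_⟩
  · rw [hlap u hu, hlu]; ring
  · rw [hlap v hv, hlv]; ring

/-- Two-point estimate: the product `u(y) v(z)` decays quadratically near the diagonal. -/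
theorem two_point_ball {n : ℕ} (hn : 2 ≤ n) {u v : EuclideanSpace ℝ (Fin n) → ℝ}
    (hsol : IsSolution u v) {x : EuclideanSpace ℝ (Fin n)} {ρ l S : ℝ} (hρ : 0 < ρ) (hl : 0 < l)
    (hS : ∀ y z, ‖y - x‖ ≤ 2 * ρ → ‖z - x‖ ≤ 2 * ρ → u y * v z ≤ S)
    {y z : EuclideanSpace ℝ (Fin n)} (hy : ‖y - x‖ ≤ ρ / 2) (hz : ‖z - x‖ ≤ ρ / 2) :
    u y * v z ≤ 15 * n ^ 2 * (S / ρ ^ 2 + 1 / l ^ 4) * (l + ‖y - z‖) ^ 2 := by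
  have hsub : ∀ y : EuclideanSpace ℝ (Fin n), x + ρ • (ρ⁻¹ • (y - x)) = y := by
    intro y
    rw [smul_smul, mul_inv_cancel₀ hρ.ne', one_smul, add_sub_cancel]
  have hnorm : ∀ y : EuclideanSpace ℝ (Fin n), ‖ρ⁻¹ • y‖ = ‖y‖ / ρ := by
    intro y
    rw [norm_smul, norm_inv, Real.norm_eq_abs, abs_of_pos hρ, inv_mul_eq_div]
  have h := two_point_unit hn (hsol.scale x hρ) (l := l / ρ) (S := ρ ^ 2 * S) (by positivity)
    (fun y z hy hz => by
      have hb : ∀ y : EuclideanSpace ℝ (Fin n), ‖y‖ ≤ 2 → ‖(x + ρ • y) - x‖ ≤ 2 * ρ := by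
        intro y hy
        rw [add_sub_cancel_left, norm_smul, Real.norm_eq_abs, abs_of_pos hρ]
        nlinarith
      have := mul_le_mul_of_nonneg_left (hS _ _ (hb y hy) (hb z hz)) (sq_nonneg ρ)
      calc _ = ρ ^ 2 * (u (x + ρ • y) * v (x + ρ • z)) := by ring
        _ ≤ _ := this)
    (x := ρ⁻¹ • (y - x)) (y := ρ⁻¹ • (z - x))
    (by rw [hnorm, div_le_iff₀ hρ]; linarith) (by rw [hnorm, div_le_iff₀ hρ]; linarith)
  simp only [hsub] at h
  rw [← smul_sub, hnorm, sub_sub_sub_cancel_right] at h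
  have e : 15 * n ^ 2 * (ρ ^ 2 * S + 1 / (l / ρ) ^ 4) * (l / ρ + ‖y - z‖ / ρ) ^ 2 =
      ρ ^ 2 * (15 * n ^ 2 * (S / ρ ^ 2 + 1 / l ^ 4) * (l + ‖y - z‖) ^ 2) := by
    field_simp
  rw [e] at h
  have h2 : ρ ^ 2 * (u y * v z) ≤
      ρ ^ 2 * (15 * n ^ 2 * (S / ρ ^ 2 + 1 / l ^ 4) * (l + ‖y - z‖) ^ 2) := by
    calc _ = ρ * u y * (ρ * v z) := by ring
      _ ≤ _ := h
  exact le_of_mul_le_mul_left h2 (by positivity)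

/-! ### Weighted means -/

/-- The weight `(1 - |y|²)₊`. -/
def wOne {n : ℕ} (y : EuclideanSpace ℝ (Fin n)) : ℝ := max (1 - ‖y‖ ^ 2) 0

/-- The weight `((1 - |y|²)₊)²`. -/
def wTwo {n : ℕ} (y : EuclideanSpace ℝ (Fin n)) : ℝ := wOne y ^ 2

/-- The mean of `f` over `B_ρ(x)` with weight `wOne`. -/
def avOne {n : ℕ} (f : EuclideanSpace ℝ (Fin n) → ℝ) (x : EuclideanSpace ℝ (Fin n)) (ρ : ℝ) : ℝ :=
  ∫ y, f (x + ρ • y) * wOne y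

/-- The mean of `f` over `B_ρ(x)` with weight `wTwo`. -/
def avTwo {n : ℕ} (f : EuclideanSpace ℝ (Fin n) → ℝ) (x : EuclideanSpace ℝ (Fin n)) (ρ : ℝ) : ℝ :=
  ∫ y, f (x + ρ • y) * wTwo y

theorem wOne_nonneg {n : ℕ} (y : EuclideanSpace ℝ (Fin n)) : 0 ≤ wOne y := le_max_right _ _

theorem wTwo_nonneg {n : ℕ} (y : EuclideanSpace ℝ (Fin n)) : 0 ≤ wTwo y := sq_nonneg _

theorem wOne_le_one {n : ℕ} (y : EuclideanSpace ℝ (Fin n)) : wOne y ≤ 1 :=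
  max_le (by linarith [sq_nonneg ‖y‖]) zero_le_one

theorem wTwo_le_wOne {n : ℕ} (y : EuclideanSpace ℝ (Fin n)) : wTwo y ≤ wOne y := by
  rw [wTwo]; nlinarith [wOne_nonneg y, wOne_le_one y]

theorem wOne_eq_zero {n : ℕ} {y : EuclideanSpace ℝ (Fin n)} (hy : 1 ≤ ‖y‖) : wOne y = 0 :=
  max_eq_right (by nlinarith)

theorem wTwo_eq_zero {n : ℕ} {y : EuclideanSpace ℝ (Fin n)} (hy : 1 ≤ ‖y‖) : wTwo y = 0 := by
  rw [wTwo, wOne_eq_zero hy]; norm_num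

theorem continuous_wOne {n : ℕ} : Continuous (wOne : EuclideanSpace ℝ (Fin n) → ℝ) := by
  unfold wOne; fun_prop

theorem continuous_wTwo {n : ℕ} : Continuous (wTwo : EuclideanSpace ℝ (Fin n) → ℝ) :=
  continuous_wOne.pow 2

theorem hasCompactSupport_of_one_le {n : ℕ} {w : EuclideanSpace ℝ (Fin n) → ℝ}
    (hw : ∀ y, 1 ≤ ‖y‖ → w y = 0) : HasCompactSupport w := by
  refine HasCompactSupport.intro (isCompact_closedBall (0 : EuclideanSpace ℝ (Fin n)) 1) ?_
  intro y hy
  rw [mem_closedBall_zero_iff, not_le] at hy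
  exact hw y hy.le

theorem integrable_mul_weight {n : ℕ} {f w : EuclideanSpace ℝ (Fin n) → ℝ} (hf : Continuous f)
    (hwc : Continuous w) (hw : ∀ y, 1 ≤ ‖y‖ → w y = 0) : Integrable (fun y => f y * w y) :=
  (hf.mul hwc).integrable_of_hasCompactSupport (hasCompactSupport_of_one_le hw).mul_left

theorem integrable_mul_wOne {n : ℕ} {f : EuclideanSpace ℝ (Fin n) → ℝ} (hf : Continuous f) :
    Integrable (fun y => f y * wOne y) :=
  integrable_mul_weight hf continuous_wOne fun _ => wOne_eq_zero

theorem integrable_mul_wTwo {n : ℕ} {f : EuclideanSpace ℝ (Fin n) → ℝ} (hf : Continuous f) :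
    Integrable (fun y => f y * wTwo y) :=
  integrable_mul_weight hf continuous_wTwo fun _ => wTwo_eq_zero

theorem continuous_comp_affine {n : ℕ} {f : EuclideanSpace ℝ (Fin n) → ℝ} (hf : Continuous f)
    (x : EuclideanSpace ℝ (Fin n)) (ρ : ℝ) : Continuous fun y => f (x + ρ • y) :=
  hf.comp (by fun_prop)

theorem continuous_radial {n : ℕ} {f : EuclideanSpace ℝ (Fin n) → ℝ}
    (hf : ContDiff ℝ (⊤ : ℕ∞) f) (x : EuclideanSpace ℝ (Fin n)) (ρ : ℝ) :
    Continuous fun y => fderiv ℝ f (x + ρ • y) y := by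
  have := hf.continuous_fderiv (by simp)
  fun_prop

theorem hasDerivAt_weighted_mean {n : ℕ} {f w : EuclideanSpace ℝ (Fin n) → ℝ}
    (hf : ContDiff ℝ (⊤ : ℕ∞) f) (hwc : Continuous w) (hw : ∀ y, 1 ≤ ‖y‖ → w y = 0)
    (x : EuclideanSpace ℝ (Fin n)) (ρ : ℝ) :
    HasDerivAt (fun ρ => ∫ y, f (x + ρ • y) * w y)
      (∫ y, fderiv ℝ f (x + ρ • y) y * w y) ρ := by
  have hfc : Continuous (fderiv ℝ f) := hf.continuous_fderiv (by simp)
  have hcont : Continuous fun p : ℝ × EuclideanSpace ℝ (Fin n) => fderiv ℝ f (x + p.1 • p.2) p.2 := by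
    fun_prop
  obtain ⟨C, hC⟩ := ((isCompact_closedBall ρ 1).prod
    (isCompact_closedBall (0 : EuclideanSpace ℝ (Fin n)) 1)).exists_bound_of_continuousOn
      hcont.continuousOn
  refine (hasDerivAt_integral_of_dominated_loc_of_deriv_le (s := ball ρ 1)
    (bound := fun y => C * ‖w y‖) (F := fun ρ y => f (x + ρ • y) * w y)
    (F' := fun ρ y => fderiv ℝ f (x + ρ • y) y * w y)
    (ball_mem_nhds ρ one_pos) ?_ ?_ ?_ ?_ ?_ ?_).2
  · exact Filter.Eventually.of_forall fun σ =>
      ((continuous_comp_affine hf.continuous x σ).mul hwc).aestronglyMeasurable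
  · exact integrable_mul_weight (continuous_comp_affine hf.continuous x ρ) hwc hw
  · exact ((continuous_radial hf x ρ).mul hwc).aestronglyMeasurable
  · refine Filter.Eventually.of_forall fun y σ hσ => ?_
    rcases le_or_gt 1 ‖y‖ with hy | hy
    · simp [hw y hy]
    · rw [norm_mul]
      exact mul_le_mul_of_nonneg_right
        (hC (σ, y) ⟨ball_subset_closedBall hσ, by simpa using hy.le⟩) (norm_nonneg _)
  · exact integrable_mul_weight continuous_const hwc.norm fun y hy => by simp [hw y hy]
  · refine Filter.Eventually.of_forall fun y σ _ => ?_
    have h1 : HasDerivAt (fun σ : ℝ => x + σ • y) y σ := by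
      simpa using ((hasDerivAt_id σ).smul_const y).const_add x
    exact ((hf.differentiable (by simp) _).hasFDerivAt.comp_hasDerivAt σ h1).mul_const _

theorem hasDerivAt_max_sq (t : ℝ) : HasDerivAt (fun t : ℝ => max t 0 ^ 2) (2 * max t 0) t := by
  rcases lt_trichotomy t 0 with h | h | h
  · rw [max_eq_right h.le, mul_zero]
    refine (hasDerivAt_const t (0 : ℝ)).congr_of_eventuallyEq ?_
    filter_upwards [gt_mem_nhds h] with s hs
    rw [max_eq_right hs.le]; norm_num
  · subst h
    rw [max_self, mul_zero]
    have : HasFDerivAt (fun t : ℝ => max t 0 ^ 2) (0 : ℝ →L[ℝ] ℝ) 0 := by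
      refine Asymptotics.IsBigO.hasFDerivAt (n := 2) (Asymptotics.IsBigO.of_bound 1 ?_)
        (by norm_num)
      refine Filter.Eventually.of_forall fun s => ?_
      rw [sub_zero, one_mul, norm_pow, norm_pow, norm_norm]
      have : ‖max s 0‖ ≤ ‖s‖ := by
        rw [Real.norm_eq_abs, Real.norm_eq_abs, abs_of_nonneg (le_max_right _ _)]
        exact max_le (le_abs_self s) (abs_nonneg s)
      gcongr
    simpa using this.hasDerivAt
  · rw [max_eq_left h.le]
    refine (hasDerivAt_pow 2 t).congr_of_eventuallyEq ?_ |>.congr_deriv (by simp)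
    filter_upwards [lt_mem_nhds h] with s hs
    rw [max_eq_left hs.le]

theorem hasFDerivAt_wTwo {n : ℕ} (y : EuclideanSpace ℝ (Fin n)) :
    HasFDerivAt (wTwo : EuclideanSpace ℝ (Fin n) → ℝ) ((-(4 * wOne y)) • innerSL ℝ y) y := by
  have h1 : HasFDerivAt (fun y : EuclideanSpace ℝ (Fin n) => 1 - ‖y‖ ^ 2)
      (-((2 : ℝ) • innerSL ℝ y)) y := by
    simpa [two_smul, two_nsmul] using ((hasStrictFDerivAt_norm_sq y).hasFDerivAt).const_sub 1
  have h2 := (hasDerivAt_max_sq (1 - ‖y‖ ^ 2)).comp_hasFDerivAt y h1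
  refine h2.congr_fderiv ?_
  rw [smul_neg, smul_smul, neg_smul]
  congr 2
  rw [wOne]; ring

theorem integral_fderiv_mul_wTwo {n : ℕ} {G : EuclideanSpace ℝ (Fin n) → ℝ}
    (hG : ContDiff ℝ (⊤ : ℕ∞) G) (x p : EuclideanSpace ℝ (Fin n)) (ρ : ℝ) :
    ρ * ∫ y, fderiv ℝ G (x + ρ • y) p * wTwo y = 4 * ∫ y, G (x + ρ • y) * (⟪y, p⟫ * wOne y) := by
  have haff : ∀ y : EuclideanSpace ℝ (Fin n), HasFDerivAt (fun z => x + ρ • z)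
      (ρ • ContinuousLinearMap.id ℝ (EuclideanSpace ℝ (Fin n))) y := fun y =>
    ((hasFDerivAt_id y).const_smul ρ).const_add x
  have hd : ∀ y, HasFDerivAt (fun z => G (x + ρ • z))
      ((fderiv ℝ G (x + ρ • y)).comp
        (ρ • ContinuousLinearMap.id ℝ (EuclideanSpace ℝ (Fin n)))) y := fun y =>
    ((hG.differentiable (by simp) _).hasFDerivAt).comp y (haff y)
  have e1 : ∀ y, fderiv ℝ (fun z => G (x + ρ • z)) y p = ρ * fderiv ℝ G (x + ρ • y) p := by
    intro y
    rw [(hd y).fderiv]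
    simp
  have e2 : ∀ y, fderiv ℝ (wTwo : EuclideanSpace ℝ (Fin n) → ℝ) y p = -(4 * (⟪y, p⟫ * wOne y)) := by
    intro y
    rw [(hasFDerivAt_wTwo y).fderiv]
    simp
    ring
  have hGc := continuous_comp_affine hG.continuous x ρ
  have hG'c : Continuous fun y => fderiv ℝ G (x + ρ • y) p :=
    continuous_comp_affine (contDiff_fderiv_apply hG p).continuous x ρ
  have hip : Continuous fun y : EuclideanSpace ℝ (Fin n) => ⟪y, p⟫ * wOne y :=
    (by fun_prop : Continuous fun y : EuclideanSpace ℝ (Fin n) => ⟪y, p⟫).mul continuous_wOne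
  have hip0 : ∀ y : EuclideanSpace ℝ (Fin n), 1 ≤ ‖y‖ → ⟪y, p⟫ * wOne y = 0 := fun y hy => by
    rw [wOne_eq_zero hy, mul_zero]
  have h := integral_mul_fderiv_eq_neg_fderiv_mul_of_integrable (μ := volume)
    (f := fun z => G (x + ρ • z)) (g := wTwo) (v := p)
    (by
      simp only [e1]
      exact integrable_mul_wTwo (continuous_const.mul hG'c))
    (by
      simp only [e2]
      exact integrable_mul_weight hGc (continuous_const.mul hip).neg fun y hy => by simp [hip0 y hy])
    (integrable_mul_wTwo hGc)
    (fun y _ => (hd y).differentiableAt)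
    (fun y _ => (hasFDerivAt_wTwo y).differentiableAt)
  simp only [e1, e2] at h
  rw [← integral_const_mul, ← integral_const_mul]
  have e3 : ∀ y, G (x + ρ • y) * -(4 * (⟪y, p⟫ * wOne y)) =
      -(4 * (G (x + ρ • y) * (⟪y, p⟫ * wOne y))) := fun y => by ring
  simp only [e3, integral_neg, neg_inj] at h
  rw [h]
  exact integral_congr_ae (Filter.Eventually.of_forall fun y => by ring)

theorem sum_single_smul {n : ℕ} (y : EuclideanSpace ℝ (Fin n)) :
    ∑ i, ⟪y, EuclideanSpace.single i (1 : ℝ)⟫ • EuclideanSpace.single i (1 : ℝ) = y := by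
  have := (EuclideanSpace.basisFun (Fin n) ℝ).sum_repr' y
  simp only [EuclideanSpace.basisFun_apply] at this
  conv_rhs => rw [← this]
  exact Finset.sum_congr rfl fun i _ => by rw [real_inner_comm]

theorem sum_inner_single_mul {n : ℕ} (L : EuclideanSpace ℝ (Fin n) →L[ℝ] ℝ)
    (y : EuclideanSpace ℝ (Fin n)) :
    ∑ i, L (EuclideanSpace.single i (1 : ℝ)) * ⟪y, EuclideanSpace.single i (1 : ℝ)⟫ = L y := by
  conv_rhs => rw [← sum_single_smul y]
  rw [map_sum]
  refine Finset.sum_congr rfl fun i _ => ?_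
  rw [map_smul, smul_eq_mul, mul_comm]

theorem lap_eq_sum_single {n : ℕ} {u : EuclideanSpace ℝ (Fin n) → ℝ}
    (hu : ContDiff ℝ (⊤ : ℕ∞) u) (x : EuclideanSpace ℝ (Fin n)) :
    lap u x = ∑ i, dirTwo u (EuclideanSpace.single i 1) x := by
  simpa using lap_eq_sum_dirTwo hu (EuclideanSpace.basisFun (Fin n) ℝ) x

/-- Divergence theorem for weighted means. -/
theorem integral_div_mul_wTwo {n : ℕ} {G : Fin n → EuclideanSpace ℝ (Fin n) → ℝ}
    (hG : ∀ i, ContDiff ℝ (⊤ : ℕ∞) (G i)) (x : EuclideanSpace ℝ (Fin n)) (ρ : ℝ) :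
    ρ * ∫ y, (∑ i, fderiv ℝ (G i) (x + ρ • y) (EuclideanSpace.single i 1)) * wTwo y =
      4 * ∫ y, (∑ i, G i (x + ρ • y) * ⟪y, EuclideanSpace.single i (1 : ℝ)⟫) * wOne y := by
  simp only [Finset.sum_mul]
  rw [integral_finsetSum, integral_finsetSum, Finset.mul_sum, Finset.mul_sum]
  · refine Finset.sum_congr rfl fun i _ => ?_
    rw [integral_fderiv_mul_wTwo (hG i)]
    simp only [mul_assoc]
  · intro i _
    exact integrable_mul_wOne ((continuous_comp_affine (hG i).continuous x ρ).mul (by fun_prop))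
  · intro i _
    exact integrable_mul_wTwo
      (continuous_comp_affine (contDiff_fderiv_apply (hG i) _).continuous x ρ)

theorem continuous_lap {n : ℕ} {u : EuclideanSpace ℝ (Fin n) → ℝ}
    (hu : ContDiff ℝ (⊤ : ℕ∞) u) : Continuous (lap u) := by
  rw [funext (lap_eq_sum_single hu)]
  exact continuous_finsetSum _ fun i _ =>
    (contDiff_fderiv_apply (contDiff_fderiv_apply hu _) _).continuous

theorem integral_radial_eq {n : ℕ} {f : EuclideanSpace ℝ (Fin n) → ℝ}
    (hf : ContDiff ℝ (⊤ : ℕ∞) f) (x : EuclideanSpace ℝ (Fin n)) (ρ : ℝ) :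
    ∫ y, fderiv ℝ f (x + ρ • y) y * wOne y = ρ / 4 * avTwo (lap f) x ρ := by
  have h := integral_div_mul_wTwo
    (G := fun i y => fderiv ℝ f y (EuclideanSpace.single i 1))
    (fun i => contDiff_fderiv_apply hf _) x ρ
  simp only [sum_inner_single_mul] at h
  have e : avTwo (lap f) x ρ = ∫ y, (∑ i, fderiv ℝ (fun z => fderiv ℝ f z
      (EuclideanSpace.single i 1)) (x + ρ • y) (EuclideanSpace.single i 1)) * wTwo y := by
    simp only [avTwo, lap_eq_sum_single hf]
    rfl
  rw [e]
  linarith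

theorem hasDerivAt_avOne {n : ℕ} {f : EuclideanSpace ℝ (Fin n) → ℝ}
    (hf : ContDiff ℝ (⊤ : ℕ∞) f) (x : EuclideanSpace ℝ (Fin n)) (ρ : ℝ) :
    HasDerivAt (avOne f x) (ρ / 4 * avTwo (lap f) x ρ) ρ := by
  rw [← integral_radial_eq hf]
  exact hasDerivAt_weighted_mean hf continuous_wOne (fun _ => wOne_eq_zero) x ρ

/-- The total mass of `wOne`. -/
def wMass (n : ℕ) : ℝ := ∫ y : EuclideanSpace ℝ (Fin n), wOne y

theorem wMass_pos (n : ℕ) : 0 < wMass n := by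
  refine continuous_wOne.integral_pos_of_hasCompactSupport_nonneg_nonzero (x := 0)
    (hasCompactSupport_of_one_le fun _ => wOne_eq_zero) (fun y => wOne_nonneg y) ?_
  simp [wOne]

theorem avOne_zero {n : ℕ} (f : EuclideanSpace ℝ (Fin n) → ℝ) (x : EuclideanSpace ℝ (Fin n)) :
    avOne f x 0 = f x * wMass n := by
  simp [avOne, wMass, integral_const_mul]

theorem avOne_mono_fun {n : ℕ} {f g : EuclideanSpace ℝ (Fin n) → ℝ} (hf : Continuous f)
    (hg : Continuous g) {x : EuclideanSpace ℝ (Fin n)} {ρ : ℝ} (hρ : 0 ≤ ρ)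
    (h : ∀ y, ‖y - x‖ ≤ ρ → f y ≤ g y) : avOne f x ρ ≤ avOne g x ρ := by
  refine integral_mono (integrable_mul_wOne (continuous_comp_affine hf x ρ))
    (integrable_mul_wOne (continuous_comp_affine hg x ρ)) fun y => ?_
  rcases le_or_gt 1 ‖y‖ with hy | hy
  · simp [wOne_eq_zero hy]
  · refine mul_le_mul_of_nonneg_right (h _ ?_) (wOne_nonneg y)
    rw [add_sub_cancel_left, norm_smul, Real.norm_eq_abs, abs_of_nonneg hρ]
    nlinarith

theorem avTwo_mono_fun {n : ℕ} {f g : EuclideanSpace ℝ (Fin n) → ℝ} (hf : Continuous f)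
    (hg : Continuous g) {x : EuclideanSpace ℝ (Fin n)} {ρ : ℝ} (hρ : 0 ≤ ρ)
    (h : ∀ y, ‖y - x‖ ≤ ρ → f y ≤ g y) : avTwo f x ρ ≤ avTwo g x ρ := by
  refine integral_mono (integrable_mul_wTwo (continuous_comp_affine hf x ρ))
    (integrable_mul_wTwo (continuous_comp_affine hg x ρ)) fun y => ?_
  rcases le_or_gt 1 ‖y‖ with hy | hy
  · simp [wTwo_eq_zero hy]
  · refine mul_le_mul_of_nonneg_right (h _ ?_) (wTwo_nonneg y)
    rw [add_sub_cancel_left, norm_smul, Real.norm_eq_abs, abs_of_nonneg hρ]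
    nlinarith

theorem avOne_nonneg {n : ℕ} {f : EuclideanSpace ℝ (Fin n) → ℝ} (hf : ∀ y, 0 ≤ f y)
    (x : EuclideanSpace ℝ (Fin n)) (ρ : ℝ) : 0 ≤ avOne f x ρ :=
  integral_nonneg fun y => mul_nonneg (hf _) (wOne_nonneg y)

theorem avTwo_nonneg {n : ℕ} {f : EuclideanSpace ℝ (Fin n) → ℝ} (hf : ∀ y, 0 ≤ f y)
    (x : EuclideanSpace ℝ (Fin n)) (ρ : ℝ) : 0 ≤ avTwo f x ρ :=
  integral_nonneg fun y => mul_nonneg (hf _) (wTwo_nonneg y)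

theorem avTwo_le_avOne {n : ℕ} {f : EuclideanSpace ℝ (Fin n) → ℝ} (hfc : Continuous f)
    (hf : ∀ y, 0 ≤ f y) (x : EuclideanSpace ℝ (Fin n)) (ρ : ℝ) : avTwo f x ρ ≤ avOne f x ρ :=
  integral_mono (integrable_mul_wTwo (continuous_comp_affine hfc x ρ))
    (integrable_mul_wOne (continuous_comp_affine hfc x ρ)) fun y =>
      mul_le_mul_of_nonneg_left (wTwo_le_wOne y) (hf _)

theorem avTwo_const_mul {n : ℕ} (c : ℝ) (f : EuclideanSpace ℝ (Fin n) → ℝ)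
    (x : EuclideanSpace ℝ (Fin n)) (ρ : ℝ) : avTwo (fun y => c * f y) x ρ = c * avTwo f x ρ := by
  simp only [avTwo, mul_assoc, integral_const_mul]

theorem avOne_add {n : ℕ} {f g : EuclideanSpace ℝ (Fin n) → ℝ} (hf : Continuous f)
    (hg : Continuous g) (x : EuclideanSpace ℝ (Fin n)) (ρ : ℝ) :
    avOne (fun y => f y + g y) x ρ = avOne f x ρ + avOne g x ρ := by
  simp only [avOne, add_mul]
  exact integral_add (integrable_mul_wOne (continuous_comp_affine hf x ρ))
    (integrable_mul_wOne (continuous_comp_affine hg x ρ))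

theorem avTwo_add {n : ℕ} {f g : EuclideanSpace ℝ (Fin n) → ℝ} (hf : Continuous f)
    (hg : Continuous g) (x : EuclideanSpace ℝ (Fin n)) (ρ : ℝ) :
    avTwo (fun y => f y + g y) x ρ = avTwo f x ρ + avTwo g x ρ := by
  simp only [avTwo, add_mul]
  exact integral_add (integrable_mul_wTwo (continuous_comp_affine hf x ρ))
    (integrable_mul_wTwo (continuous_comp_affine hg x ρ))

theorem avOne_const {n : ℕ} (c : ℝ) (x : EuclideanSpace ℝ (Fin n)) (ρ : ℝ) :
    avOne (fun _ => c) x ρ = c * wMass n := by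
  simp only [avOne, integral_const_mul, wMass]

theorem avOne_mono {n : ℕ} {f : EuclideanSpace ℝ (Fin n) → ℝ} (hf : ContDiff ℝ (⊤ : ℕ∞) f)
    (hlap : ∀ y, 0 ≤ lap f y) (x : EuclideanSpace ℝ (Fin n)) :
    MonotoneOn (avOne f x) (Set.Ici 0) := by
  refine monotoneOn_of_deriv_nonneg (convex_Ici 0)
    (fun ρ _ => (hasDerivAt_avOne hf x ρ).continuousAt.continuousWithinAt)
    (fun ρ _ => (hasDerivAt_avOne hf x ρ).differentiableAt.differentiableWithinAt) ?_
  intro ρ hρ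
  rw [interior_Ici] at hρ
  rw [(hasDerivAt_avOne hf x ρ).deriv]
  have : (0 : ℝ) < ρ := hρ
  exact mul_nonneg (by positivity) (avTwo_nonneg hlap x ρ)

theorem le_avOne {n : ℕ} {f : EuclideanSpace ℝ (Fin n) → ℝ} (hf : ContDiff ℝ (⊤ : ℕ∞) f)
    (hlap : ∀ y, 0 ≤ lap f y) (x : EuclideanSpace ℝ (Fin n)) {ρ : ℝ} (hρ : 0 ≤ ρ) :
    f x * wMass n ≤ avOne f x ρ := by
  rw [← avOne_zero]
  exact avOne_mono hf hlap x (Set.mem_Ici.2 le_rfl) hρ hρ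

/-- Harnack type inequality for `Δv = a v` with bounded potential `a`. -/
theorem avOne_le_exp_mul {n : ℕ} {v : EuclideanSpace ℝ (Fin n) → ℝ}
    (hv : ContDiff ℝ (⊤ : ℕ∞) v) (hv0 : ∀ y, 0 ≤ v y) {x : EuclideanSpace ℝ (Fin n)} {ρ K : ℝ}
    (hρ : 0 ≤ ρ) (hK : 0 ≤ K) (hlap : ∀ y, ‖y - x‖ ≤ ρ → lap v y ≤ K * v y) :
    avOne v x ρ ≤ Real.exp (K * ρ ^ 2 / 8) * (v x * wMass n) := by
  have hder : ∀ σ, HasDerivAt (fun σ => avOne v x σ * Real.exp (-(K * σ ^ 2 / 8)))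
      ((σ / 4 * avTwo (lap v) x σ) * Real.exp (-(K * σ ^ 2 / 8)) +
        avOne v x σ * (Real.exp (-(K * σ ^ 2 / 8)) * -(K * (2 * σ) / 8))) σ := by
    intro σ
    refine (hasDerivAt_avOne hv x σ).mul (HasDerivAt.exp ?_)
    refine ((((hasDerivAt_pow 2 σ).const_mul K).div_const 8).neg).congr_deriv ?_
    simp
  have hanti : AntitoneOn (fun σ => avOne v x σ * Real.exp (-(K * σ ^ 2 / 8))) (Set.Icc 0 ρ) := by
    refine antitoneOn_of_deriv_nonpos (convex_Icc 0 ρ)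
      (fun σ _ => (hder σ).continuousAt.continuousWithinAt)
      (fun σ _ => (hder σ).differentiableAt.differentiableWithinAt) ?_
    intro σ hσ
    rw [interior_Icc] at hσ
    rw [(hder σ).deriv]
    have h1 : avTwo (lap v) x σ ≤ K * avOne v x σ := by
      calc avTwo (lap v) x σ ≤ avTwo (fun y => K * v y) x σ :=
            avTwo_mono_fun (continuous_lap hv) (continuous_const.mul hv.continuous) hσ.1.le
              fun y hy => hlap y (hy.trans hσ.2.le)
        _ = K * avTwo v x σ := avTwo_const_mul _ _ _ _
        _ ≤ K * avOne v x σ := by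
            gcongr
            exact avTwo_le_avOne hv.continuous hv0 x σ
    have h2 : 0 ≤ σ / 4 * Real.exp (-(K * σ ^ 2 / 8)) := by
      have := hσ.1
      positivity
    nlinarith [mul_le_mul_of_nonneg_left h1 h2]
  have h := hanti (Set.left_mem_Icc.2 hρ) (Set.right_mem_Icc.2 hρ) hρ
  simp only [avOne_zero] at h
  rw [Real.exp_neg] at h
  have he := Real.exp_pos (K * ρ ^ 2 / 8)
  rw [← div_eq_mul_inv, div_le_iff₀ he] at h
  simpa [mul_comm] using h

theorem integral_comp_affine {n : ℕ} (f w : EuclideanSpace ℝ (Fin n) → ℝ)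
    (x : EuclideanSpace ℝ (Fin n)) {ρ : ℝ} (hρ : 0 < ρ) :
    ∫ y, f (x + ρ • y) * w y = (ρ ^ n)⁻¹ * ∫ y, f y * w (ρ⁻¹ • (y - x)) := by
  have h1 := Measure.integral_comp_smul (volume : Measure (EuclideanSpace ℝ (Fin n)))
    (fun z => f (x + z) * w (ρ⁻¹ • z)) ρ
  simp only [smul_smul, inv_mul_cancel₀ hρ.ne', one_smul, finrank_euclideanSpace,
    Fintype.card_fin, smul_eq_mul] at h1
  rw [h1, abs_of_pos (by positivity)]
  congr 1
  rw [← integral_add_left_eq_self (μ := volume) (fun y => f y * w (ρ⁻¹ • (y - x))) x]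
  simp

theorem avOne_le_of_subset {n : ℕ} {f : EuclideanSpace ℝ (Fin n) → ℝ} (hfc : Continuous f)
    (hf : ∀ y, 0 ≤ f y) {x z : EuclideanSpace ℝ (Fin n)} {ρ R : ℝ} (hρ : 0 < ρ)
    (hR : 2 * (‖z - x‖ + ρ) ≤ R) :
    avOne f z ρ ≤ 4 / 3 * (R / ρ) ^ n * avOne f x R := by
  have hR0 : 0 < R := by linarith [norm_nonneg (z - x)]
  have hint : ∀ (c : EuclideanSpace ℝ (Fin n)) (σ : ℝ), 0 < σ →
      Integrable fun y => f y * wOne (σ⁻¹ • (y - c)) := by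
    intro c σ hσ
    refine Continuous.integrable_of_hasCompactSupport
      (hfc.mul (continuous_wOne.comp (by fun_prop))) ?_
    refine HasCompactSupport.mul_left ?_
    refine HasCompactSupport.intro (isCompact_closedBall c σ) fun y hy => ?_
    rw [mem_closedBall, dist_eq_norm, not_le] at hy
    refine wOne_eq_zero ?_
    rw [norm_smul, norm_inv, Real.norm_eq_abs, abs_of_pos hσ, inv_mul_eq_div, le_div_iff₀ hσ]
    linarith
  have key : ∫ y, f y * wOne (ρ⁻¹ • (y - z)) ≤ 4 / 3 * ∫ y, f y * wOne (R⁻¹ • (y - x)) := by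
    rw [← integral_const_mul]
    refine integral_mono (hint z ρ hρ) ((hint x R hR0).const_mul _) fun y => ?_
    have h0 := mul_nonneg (hf y) (wOne_nonneg (R⁻¹ • (y - x)))
    rcases le_or_gt 1 ‖ρ⁻¹ • (y - z)‖ with hy | hy
    · simp only [wOne_eq_zero hy]
      linarith
    · rw [norm_smul, norm_inv, Real.norm_eq_abs, abs_of_pos hρ, inv_mul_eq_div,
        div_lt_one hρ] at hy
      have h1 : ‖R⁻¹ • (y - x)‖ ≤ 1 / 2 := by
        rw [norm_smul, norm_inv, Real.norm_eq_abs, abs_of_pos hR0, inv_mul_eq_div, div_le_iff₀ hR0]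
        have : ‖y - x‖ ≤ ‖y - z‖ + ‖z - x‖ := norm_sub_le_norm_sub_add_norm_sub y z x
        linarith
      have h2 : 3 / 4 ≤ wOne (R⁻¹ • (y - x)) := by
        refine le_max_of_le_left ?_
        nlinarith [norm_nonneg (R⁻¹ • (y - x))]
      have h3 := wOne_le_one (ρ⁻¹ • (y - z))
      simp only
      nlinarith [mul_le_mul_of_nonneg_left h3 (hf y), mul_le_mul_of_nonneg_left h2 (hf y)]
  rw [avOne, avOne, integral_comp_affine f wOne z hρ, integral_comp_affine f wOne x hR0]
  calc _ ≤ (ρ ^ n)⁻¹ * (4 / 3 * ∫ y, f y * wOne (R⁻¹ • (y - x))) := by gcongr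
    _ = _ := by
      rw [div_pow]
      field_simp

/-! ### Gradients and squares -/

/-- The squared length of the gradient, in coordinates. -/
def gradSq {n : ℕ} (u : EuclideanSpace ℝ (Fin n) → ℝ) (y : EuclideanSpace ℝ (Fin n)) : ℝ :=
  ∑ i, fderiv ℝ u y (EuclideanSpace.single i 1) ^ 2

theorem gradSq_nonneg {n : ℕ} (u : EuclideanSpace ℝ (Fin n) → ℝ) (y : EuclideanSpace ℝ (Fin n)) :
    0 ≤ gradSq u y := Finset.sum_nonneg fun _ _ => sq_nonneg _

theorem contDiff_gradSq {n : ℕ} {u : EuclideanSpace ℝ (Fin n) → ℝ}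
    (hu : ContDiff ℝ (⊤ : ℕ∞) u) : ContDiff ℝ (⊤ : ℕ∞) (gradSq u) :=
  ContDiff.sum fun _ _ => (contDiff_fderiv_apply hu _).pow 2

theorem norm_gradient_sq {n : ℕ} {u : EuclideanSpace ℝ (Fin n) → ℝ}
    (y : EuclideanSpace ℝ (Fin n)) : ‖gradient u y‖ ^ 2 = gradSq u y := by
  rw [EuclideanSpace.norm_sq_eq, gradSq]
  refine Finset.sum_congr rfl fun i _ => ?_
  have h : fderiv ℝ u y (EuclideanSpace.single i 1) =
      ⟪gradient u y, EuclideanSpace.single i (1 : ℝ)⟫ := by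
    rw [gradient, InnerProductSpace.toDual_symm_apply]
  rw [h, EuclideanSpace.inner_single_right]
  simp

theorem lap_sq {n : ℕ} {u : EuclideanSpace ℝ (Fin n) → ℝ} (hu : ContDiff ℝ (⊤ : ℕ∞) u)
    (x : EuclideanSpace ℝ (Fin n)) :
    lap (fun y => u y ^ 2) x = 2 * (gradSq u x + u x * lap u x) := by
  have hd : Differentiable ℝ u := hu.differentiable (by simp)
  have h1 : ∀ y p, fderiv ℝ (fun y => u y ^ 2) y p = 2 * (u y * fderiv ℝ u y p) := by
    intro y p
    rw [((hd y).hasFDerivAt.pow 2).fderiv]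
    simp
    ring
  have h2 : ∀ p, dirTwo (fun y => u y ^ 2) p x =
      2 * (fderiv ℝ u x p ^ 2 + u x * dirTwo u p x) := by
    intro p
    have hd2 : DifferentiableAt ℝ (fun y => fderiv ℝ u y p) x :=
      (contDiff_fderiv_apply hu p).differentiable (by simp) x
    have h3 : HasFDerivAt (fun y => 2 * (u y * fderiv ℝ u y p)) _ x :=
      ((hd x).hasFDerivAt.mul hd2.hasFDerivAt).const_mul 2
    rw [dirTwo, funext fun y => h1 y p, h3.fderiv]
    simp [dirTwo]
    ring
  rw [lap_eq_sum_single (hu.pow 2), lap_eq_sum_single hu, gradSq, Finset.mul_sum,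
    ← Finset.sum_add_distrib, Finset.mul_sum]
  exact Finset.sum_congr rfl fun i _ => h2 _

/-! ### The Almgren frequency -/

theorem fderiv_fderiv_apply {n : ℕ} {f : EuclideanSpace ℝ (Fin n) → ℝ}
    (hf : ContDiff ℝ (⊤ : ℕ∞) f) (ξ p q : EuclideanSpace ℝ (Fin n)) :
    fderiv ℝ (fun y => fderiv ℝ f y p) ξ q = fderiv ℝ (fderiv ℝ f) ξ q p := by
  have hd : DifferentiableAt ℝ (fderiv ℝ f) ξ :=
    ((hf.fderiv_right (m := (⊤ : ℕ∞)) le_rfl).differentiable (by simp)) ξ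
  rw [show (fun y => fderiv ℝ f y p) = fun y => (fderiv ℝ f y) ((fun _ => p) y) from rfl]
  rw [fderiv_clm_apply hd (by fun_prop)]
  simp

theorem fderiv_radial {n : ℕ} {f : EuclideanSpace ℝ (Fin n) → ℝ}
    (hf : ContDiff ℝ (⊤ : ℕ∞) f) (x ξ q : EuclideanSpace ℝ (Fin n)) :
    fderiv ℝ (fun y => fderiv ℝ f y (y - x)) ξ q =
      fderiv ℝ f ξ q + fderiv ℝ (fderiv ℝ f) ξ q (ξ - x) := by
  have hd : DifferentiableAt ℝ (fderiv ℝ f) ξ :=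
    ((hf.fderiv_right (m := (⊤ : ℕ∞)) le_rfl).differentiable (by simp)) ξ
  have hs : fderiv ℝ (fun y : EuclideanSpace ℝ (Fin n) => y - x) ξ = .id ℝ _ :=
    ((hasFDerivAt_id ξ).sub_const x).fderiv
  rw [fderiv_clm_apply hd (by fun_prop), hs]
  simp

theorem contDiff_radial {n : ℕ} {f : EuclideanSpace ℝ (Fin n) → ℝ}
    (hf : ContDiff ℝ (⊤ : ℕ∞) f) (x : EuclideanSpace ℝ (Fin n)) :
    ContDiff ℝ (⊤ : ℕ∞) (fun y => fderiv ℝ f y (y - x)) :=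
  (hf.fderiv_right (m := (⊤ : ℕ∞)) le_rfl).clm_apply (contDiff_id.sub contDiff_const)

theorem fderiv_gradSq {n : ℕ} {f : EuclideanSpace ℝ (Fin n) → ℝ}
    (hf : ContDiff ℝ (⊤ : ℕ∞) f) (ξ q : EuclideanSpace ℝ (Fin n)) :
    fderiv ℝ (gradSq f) ξ q = ∑ i, 2 * (fderiv ℝ f ξ (EuclideanSpace.single i 1) *
      fderiv ℝ (fderiv ℝ f) ξ q (EuclideanSpace.single i 1)) := by
  have h : HasFDerivAt (gradSq f) _ ξ := HasFDerivAt.fun_sum (u := Finset.univ) fun i _ =>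
    (((contDiff_fderiv_apply hf (EuclideanSpace.single i 1)).differentiable (by simp)
      ξ).hasFDerivAt.pow 2)
  rw [h.fderiv, sum_apply]
  refine Finset.sum_congr rfl fun i _ => ?_
  simp [fderiv_fderiv_apply hf]
  ring

/-- Rellich's identity for weighted means. -/
theorem rellich_identity {n : ℕ} {f : EuclideanSpace ℝ (Fin n) → ℝ}
    (hf : ContDiff ℝ (⊤ : ℕ∞) f) (x : EuclideanSpace ℝ (Fin n)) {ρ : ℝ} (hρ : 0 < ρ) :
    ∫ y, (2 * gradSq f (x + ρ • y) + fderiv ℝ (gradSq f) (x + ρ • y) (ρ • y) +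
      2 * (fderiv ℝ f (x + ρ • y) (ρ • y) * lap f (x + ρ • y))) * wTwo y =
      8 * ∫ y, fderiv ℝ f (x + ρ • y) y ^ 2 * wOne y := by
  have hsymm : ∀ ξ p q, fderiv ℝ (fderiv ℝ f) ξ p q = fderiv ℝ (fderiv ℝ f) ξ q p := fun ξ p q =>
    (hf.contDiffAt.isSymmSndFDerivAt (by
      rw [minSmoothness_of_isRCLikeNormedField]
      exact WithTop.coe_le_coe.2 le_top)) p q
  have h := integral_div_mul_wTwo
    (G := fun i y => 2 * (fderiv ℝ f y (y - x) * fderiv ℝ f y (EuclideanSpace.single i 1)))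
    (fun i => contDiff_const.mul ((contDiff_radial hf x).mul (contDiff_fderiv_apply hf _))) x ρ
  have hdiv : ∀ ξ, (∑ i, fderiv ℝ (fun y => 2 * (fderiv ℝ f y (y - x) *
      fderiv ℝ f y (EuclideanSpace.single i 1))) ξ (EuclideanSpace.single i 1)) =
      2 * gradSq f ξ + fderiv ℝ (gradSq f) ξ (ξ - x) +
        2 * (fderiv ℝ f ξ (ξ - x) * lap f ξ) := by
    intro ξ
    rw [fderiv_gradSq hf, lap_eq_sum_single hf, gradSq, Finset.mul_sum, Finset.mul_sum,
      Finset.mul_sum, ← Finset.sum_add_distrib, ← Finset.sum_add_distrib]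
    refine Finset.sum_congr rfl fun i _ => ?_
    have h3 : HasFDerivAt (fun y => 2 * (fderiv ℝ f y (y - x) *
        fderiv ℝ f y (EuclideanSpace.single i 1))) _ ξ :=
      ((((contDiff_radial hf x).differentiable (by simp) ξ).hasFDerivAt.mul
        ((contDiff_fderiv_apply hf (EuclideanSpace.single i 1)).differentiable (by simp)
          ξ).hasFDerivAt).const_mul 2)
    rw [h3.fderiv]
    simp [-map_sub, fderiv_fderiv_apply hf, fderiv_radial hf, dirTwo]
    rw [hsymm ξ (ξ - x)]
    ring
  simp only [hdiv, add_sub_cancel_left] at h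
  have hrhs : ∀ y, (∑ i, 2 * (fderiv ℝ f (x + ρ • y) (ρ • y) *
      fderiv ℝ f (x + ρ • y) (EuclideanSpace.single i 1)) *
        ⟪y, EuclideanSpace.single i (1 : ℝ)⟫) * wOne y =
      2 * ρ * (fderiv ℝ f (x + ρ • y) y ^ 2 * wOne y) := by
    intro y
    have := sum_inner_single_mul (fderiv ℝ f (x + ρ • y)) y
    calc _ = (2 * fderiv ℝ f (x + ρ • y) (ρ • y) *
          ∑ i, fderiv ℝ f (x + ρ • y) (EuclideanSpace.single i 1) *
            ⟪y, EuclideanSpace.single i (1 : ℝ)⟫) * wOne y := by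
          rw [Finset.mul_sum]
          congr 1
          exact Finset.sum_congr rfl fun i _ => by ring
      _ = _ := by
          rw [this, map_smul, smul_eq_mul]
          ring
  simp only [hrhs] at h
  rw [integral_const_mul] at h
  have h4 : ρ * (8 * ∫ y, fderiv ℝ f (x + ρ • y) y ^ 2 * wOne y) =
      4 * (2 * ρ * ∫ y, fderiv ℝ f (x + ρ • y) y ^ 2 * wOne y) := by ring
  rw [← h4] at h
  exact mul_left_cancel₀ hρ.ne' h

/-- Abstract form of the monotonicity of the frequency and its consequence on growth. -/
theorem frequency_growth {h D P X : ℝ → ℝ} {C : ℝ} (hh : ∀ ρ, 0 < ρ → 0 < h ρ)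
    (hD : ∀ ρ, 0 < ρ → 0 ≤ D ρ) (hP : ∀ ρ, 0 < ρ → 0 ≤ P ρ)
    (hh' : ∀ ρ, 0 < ρ → HasDerivAt h ((D ρ + P ρ) / ρ) ρ)
    (hD' : ∀ ρ, 0 < ρ → HasDerivAt D ((4 * X ρ + 2 * P ρ) / ρ) ρ)
    (hX : ∀ ρ, 0 < ρ → (D ρ + P ρ) ^ 2 ≤ 4 * (X ρ * h ρ))
    (hC : ∀ ρ, 1 ≤ ρ → h ρ ≤ C * ρ ^ 2) {R : ℝ} (hR : 1 ≤ R) :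
    h R ≤ Real.exp 1 * R ^ 2 * h 1 := by
  have hN' : ∀ ρ, 0 < ρ → HasDerivAt (fun ρ => D ρ / h ρ)
      (((4 * X ρ + 2 * P ρ) / ρ * h ρ - D ρ * ((D ρ + P ρ) / ρ)) / h ρ ^ 2) ρ := fun ρ hρ =>
    (hD' ρ hρ).div (hh' ρ hρ) (hh ρ hρ).ne'
  have hNge : ∀ ρ, 0 < ρ → 2 * P ρ / (ρ * h ρ) ≤
      ((4 * X ρ + 2 * P ρ) / ρ * h ρ - D ρ * ((D ρ + P ρ) / ρ)) / h ρ ^ 2 := by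
    intro ρ hρ
    have h0 := hh ρ hρ
    have e1 : ((4 * X ρ + 2 * P ρ) / ρ * h ρ - D ρ * ((D ρ + P ρ) / ρ)) / h ρ ^ 2 =
        ((4 * (X ρ * h ρ) - D ρ * (D ρ + P ρ)) + 2 * P ρ * h ρ) / (ρ * h ρ ^ 2) := by
      field_simp
      ring
    have e2 : 2 * P ρ / (ρ * h ρ) = (2 * P ρ * h ρ) / (ρ * h ρ ^ 2) := by field_simp
    rw [e1, e2]
    gcongr
    nlinarith [hX ρ hρ, mul_nonneg (hD ρ hρ) (hP ρ hρ), sq_nonneg (P ρ)]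
  have hNmono : MonotoneOn (fun ρ => D ρ / h ρ) (Set.Ioi 0) := by
    refine monotoneOn_of_deriv_nonneg (convex_Ioi 0)
      (fun ρ hρ => (hN' ρ hρ).continuousAt.continuousWithinAt)
      (fun ρ hρ => (hN' ρ (interior_subset hρ)).differentiableAt.differentiableWithinAt) ?_
    intro ρ hρ
    have hρ' : 0 < ρ := interior_subset hρ
    rw [(hN' ρ hρ').deriv]
    refine le_trans ?_ (hNge ρ hρ')
    have := hP ρ hρ'
    have := hh ρ hρ'
    positivity
  have hlog : ∀ ρ, 0 < ρ → HasDerivAt (fun ρ => Real.log (h ρ)) ((D ρ + P ρ) / ρ / h ρ) ρ :=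
    fun ρ hρ => (hh' ρ hρ).log (hh ρ hρ).ne'
  have hN2 : ∀ ρ, 0 < ρ → D ρ / h ρ ≤ 2 := by
    intro ρ₀ hρ₀
    by_contra! hgt
    obtain ⟨a, ha⟩ : ∃ a, a = D ρ₀ / h ρ₀ := ⟨_, rfl⟩
    rw [← ha] at hgt
    have hmono : MonotoneOn (fun ρ => Real.log (h ρ) - a * Real.log ρ) (Set.Ici ρ₀) := by
      have hd : ∀ ρ ∈ Set.Ici ρ₀, HasDerivAt (fun ρ => Real.log (h ρ) - a * Real.log ρ)
          ((D ρ + P ρ) / ρ / h ρ - a * ρ⁻¹) ρ := fun ρ hρ => by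
        have hρ' : 0 < ρ := hρ₀.trans_le hρ
        exact (hlog ρ hρ').sub ((Real.hasDerivAt_log hρ'.ne').const_mul a)
      refine monotoneOn_of_deriv_nonneg (convex_Ici ρ₀)
        (fun ρ hρ => (hd ρ hρ).continuousAt.continuousWithinAt)
        (fun ρ hρ => (hd ρ (interior_subset hρ)).differentiableAt.differentiableWithinAt) ?_
      intro ρ hρ
      have hρ1 : ρ ∈ Set.Ici ρ₀ := interior_subset hρ
      have hρ' : 0 < ρ := hρ₀.trans_le hρ1
      rw [(hd ρ hρ1).deriv]
      have h1 : a ≤ D ρ / h ρ := ha ▸ hNmono hρ₀ hρ' hρ1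
      have h2 : (D ρ + P ρ) / ρ / h ρ = (D ρ / h ρ + P ρ / h ρ) * ρ⁻¹ := by
        have := hh ρ hρ'
        field_simp
      have h3 : 0 ≤ P ρ / h ρ := div_nonneg (hP ρ hρ') (hh ρ hρ').le
      rw [h2, ← sub_mul]
      exact mul_nonneg (by linarith) (inv_nonneg.2 hρ'.le)
    have hC0 : 0 < C := by
      have := (hh 1 one_pos).trans_le (hC 1 le_rfl)
      simpa using this
    have hbd : ∀ ρ, max ρ₀ 1 ≤ ρ → (a - 2) * Real.log ρ ≤
        Real.log C - (Real.log (h ρ₀) - a * Real.log ρ₀) := by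
      intro ρ hρ
      have h1 : ρ₀ ≤ ρ := (le_max_left _ _).trans hρ
      have h2 : 1 ≤ ρ := (le_max_right _ _).trans hρ
      have h3 := hmono (Set.mem_Ici.2 le_rfl) (Set.mem_Ici.2 h1) h1
      have h4 := Real.log_le_log (hh ρ (by linarith)) (hC ρ h2)
      rw [Real.log_mul hC0.ne' (by positivity), Real.log_pow] at h4
      push_cast at h4
      simp only at h3
      linarith
    have htend : Filter.Tendsto (fun ρ => (a - 2) * Real.log ρ) Filter.atTop Filter.atTop :=
      Real.tendsto_log_atTop.const_mul_atTop (by linarith)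
    obtain ⟨ρ, hρ1, hρ2⟩ := ((htend.eventually_gt_atTop
      (Real.log C - (Real.log (h ρ₀) - a * Real.log ρ₀))).and
        (Filter.eventually_ge_atTop (max ρ₀ 1))).exists
    exact absurd (hbd ρ hρ2) (not_le.2 hρ1)
  have hanti : AntitoneOn (fun ρ => Real.log (h ρ) - 2 * Real.log ρ - D ρ / h ρ / 2)
      (Set.Ici 1) := by
    have hd : ∀ ρ ∈ Set.Ici (1 : ℝ), HasDerivAt
        (fun ρ => Real.log (h ρ) - 2 * Real.log ρ - D ρ / h ρ / 2)
        ((D ρ + P ρ) / ρ / h ρ - 2 * ρ⁻¹ -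
          ((4 * X ρ + 2 * P ρ) / ρ * h ρ - D ρ * ((D ρ + P ρ) / ρ)) / h ρ ^ 2 / 2) ρ := by
      intro ρ hρ
      have hρ' : 0 < ρ := one_pos.trans_le hρ
      exact ((hlog ρ hρ').sub ((Real.hasDerivAt_log hρ'.ne').const_mul 2)).sub
        ((hN' ρ hρ').div_const 2)
    refine antitoneOn_of_deriv_nonpos (convex_Ici 1)
      (fun ρ hρ => (hd ρ hρ).continuousAt.continuousWithinAt)
      (fun ρ hρ => (hd ρ (interior_subset hρ)).differentiableAt.differentiableWithinAt) ?_
    intro ρ hρ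
    have hρ1 : ρ ∈ Set.Ici (1 : ℝ) := interior_subset hρ
    have hρ' : 0 < ρ := one_pos.trans_le hρ1
    rw [(hd ρ hρ1).deriv]
    have h1 := hNge ρ hρ'
    have h0 := hh ρ hρ'
    have h2 : (D ρ + P ρ) / ρ / h ρ = D ρ / h ρ * ρ⁻¹ + 2 * P ρ / (ρ * h ρ) / 2 := by
      field_simp
    have h3 : D ρ / h ρ * ρ⁻¹ ≤ 2 * ρ⁻¹ :=
      mul_le_mul_of_nonneg_right (hN2 ρ hρ') (inv_nonneg.2 hρ'.le)
    linarith
  have h1 := hanti (Set.mem_Ici.2 le_rfl) (Set.mem_Ici.2 hR) hR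
  have hR0 : 0 < R := by linarith
  have h2 := hN2 R hR0
  have h3 : 0 ≤ D 1 / h 1 := div_nonneg (hD 1 one_pos) (hh 1 one_pos).le
  simp only [Real.log_one] at h1
  have h4 : Real.log (h R) ≤ Real.log (Real.exp 1 * R ^ 2 * h 1) := by
    rw [Real.log_mul (by positivity) (hh 1 one_pos).ne', Real.log_mul (by positivity)
      (by positivity), Real.log_exp, Real.log_pow]
    push_cast
    linarith
  exact (Real.log_le_log_iff (hh R hR0) (by have := hh 1 one_pos; positivity)).1 h4

theorem sq_le_of_quadratic_nonneg {X Y h : ℝ} (hh : 0 < h)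
    (H : ∀ t : ℝ, 0 ≤ X - 2 * t * Y + t ^ 2 * h) : Y ^ 2 ≤ X * h := by
  have h1 := H (Y / h)
  have h2 : X - 2 * (Y / h) * Y + (Y / h) ^ 2 * h = (X * h - Y ^ 2) / h := by
    field_simp
    ring
  rw [h2] at h1
  rw [le_div_iff₀ hh, zero_mul] at h1
  linarith

/-- Growth control: `h(x,R) ≤ e R² h(x,1)` where `h` is the weighted mean of `u² + v²`. -/
theorem almgren_growth {n : ℕ} {u v : EuclideanSpace ℝ (Fin n) → ℝ} (hsol : IsSolution u v)
    {x : EuclideanSpace ℝ (Fin n)} {C : ℝ}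
    (hC : ∀ ρ, 1 ≤ ρ → avOne (fun y => u y ^ 2 + v y ^ 2) x ρ ≤ C * ρ ^ 2) {R : ℝ} (hR : 1 ≤ R) :
    avOne (fun y => u y ^ 2 + v y ^ 2) x R ≤
      Real.exp 1 * R ^ 2 * avOne (fun y => u y ^ 2 + v y ^ 2) x 1 := by
  obtain ⟨hu, hv, hu0, hv0, hlu, hlv⟩ := hsol
  have hud : Differentiable ℝ u := hu.differentiable (by simp)
  have hvd : Differentiable ℝ v := hv.differentiable (by simp)
  have hsm : ContDiff ℝ (⊤ : ℕ∞) (fun y => u y ^ 2 + v y ^ 2) := (hu.pow 2).add (hv.pow 2)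
  have hpsm : ContDiff ℝ (⊤ : ℕ∞) (fun y => u y ^ 2 * v y ^ 2) := (hu.pow 2).mul (hv.pow 2)
  have hgsm : ContDiff ℝ (⊤ : ℕ∞) (fun y => gradSq u y + gradSq v y) :=
    (contDiff_gradSq hu).add (contDiff_gradSq hv)
  set E : EuclideanSpace ℝ (Fin n) → ℝ :=
    fun y => gradSq u y + gradSq v y + u y ^ 2 * v y ^ 2 with hE
  have hEsm : ContDiff ℝ (⊤ : ℕ∞) E := hgsm.add hpsm
  have hE0 : ∀ y, 0 ≤ E y := fun y => by
    have := gradSq_nonneg u y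
    have := gradSq_nonneg v y
    simp only [hE]
    positivity
  have hlap : ∀ y, lap (fun y => u y ^ 2 + v y ^ 2) y = 2 * (E y + u y ^ 2 * v y ^ 2) := by
    intro y
    have hadd : lap (fun y => u y ^ 2 + v y ^ 2) y =
        lap (fun y => u y ^ 2) y + lap (fun y => v y ^ 2) y := by
      rw [lap, lap, lap, ← Finset.sum_add_distrib]
      refine Finset.sum_congr rfl fun i _ => ?_
      rw [show (fun y => u y ^ 2 + v y ^ 2) = (fun y => u y ^ 2) + fun y => v y ^ 2 from rfl,
        iteratedFDeriv_add_apply ((hu.pow 2).of_le (WithTop.coe_le_coe.2 le_top)).contDiffAt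
          ((hv.pow 2).of_le (WithTop.coe_le_coe.2 le_top)).contDiffAt]
      rfl
    rw [hadd, lap_sq hu, lap_sq hv, hlu, hlv, hE]
    ring
  have hpos : ∀ ρ, 0 < ρ → 0 < avOne (fun y => u y ^ 2 + v y ^ 2) x ρ := by
    intro ρ hρ
    refine lt_of_lt_of_le ?_ (le_avOne hsm (fun y => ?_) x hρ.le)
    · have := hu0 x
      have := wMass_pos n
      positivity
    · rw [hlap]
      have := hE0 y
      positivity
  refine frequency_growth (h := avOne (fun y => u y ^ 2 + v y ^ 2) x)
    (D := fun ρ => ρ ^ 2 / 2 * avTwo E x ρ)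
    (P := fun ρ => ρ ^ 2 / 2 * avTwo (fun y => u y ^ 2 * v y ^ 2) x ρ)
    (X := fun ρ => ρ ^ 2 * ∫ y, (fderiv ℝ u (x + ρ • y) y ^ 2 + fderiv ℝ v (x + ρ • y) y ^ 2) *
      wOne y) hpos ?_ ?_ ?_ ?_ ?_ hC hR
  · intro ρ _
    have := avTwo_nonneg hE0 x ρ
    positivity
  · intro ρ _
    have := avTwo_nonneg (f := fun y => u y ^ 2 * v y ^ 2) (fun y => by positivity) x ρ
    positivity
  · intro ρ hρ
    refine (hasDerivAt_avOne hsm x ρ).congr_deriv ?_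
    rw [funext hlap, avTwo_const_mul, avTwo_add hEsm.continuous hpsm.continuous]
    field_simp
    ring
  · intro ρ hρ
    have hd := (((hasDerivAt_pow 2 ρ).div_const 2).mul
      (hasDerivAt_weighted_mean hEsm continuous_wTwo (fun _ => wTwo_eq_zero) x ρ))
    refine hd.congr_deriv ?_
    have hru := rellich_identity hu x hρ
    have hrv := rellich_identity hv x hρ
    have iu := integrable_mul_wOne ((continuous_radial hu x ρ).pow 2)
    have iv := integrable_mul_wOne ((continuous_radial hv x ρ).pow 2)
    have hc : ∀ f : EuclideanSpace ℝ (Fin n) → ℝ, ContDiff ℝ (⊤ : ℕ∞) f →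
        Continuous fun y => 2 * gradSq f (x + ρ • y) + fderiv ℝ (gradSq f) (x + ρ • y) (ρ • y) +
          2 * (fderiv ℝ f (x + ρ • y) (ρ • y) * lap f (x + ρ • y)) := by
      intro f hf
      have h1 := continuous_comp_affine (contDiff_gradSq hf).continuous x ρ
      have h2 := continuous_comp_affine (continuous_lap hf) x ρ
      have h3 := (contDiff_gradSq hf).continuous_fderiv (by simp)
      have h4 := hf.continuous_fderiv (by simp)
      fun_prop
    have hX : (∫ y, (fderiv ℝ u (x + ρ • y) y ^ 2 + fderiv ℝ v (x + ρ • y) y ^ 2) * wOne y) =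
        (∫ y, fderiv ℝ u (x + ρ • y) y ^ 2 * wOne y) +
          ∫ y, fderiv ℝ v (x + ρ • y) y ^ 2 * wOne y := by
      simp only [add_mul]
      exact integral_add iu iv
    have hpt : ∀ ξ q : EuclideanSpace ℝ (Fin n), fderiv ℝ E ξ q =
        fderiv ℝ (gradSq u) ξ q + fderiv ℝ (gradSq v) ξ q +
          2 * (fderiv ℝ u ξ q * lap u ξ) + 2 * (fderiv ℝ v ξ q * lap v ξ) := by
      intro ξ q
      have h3 : HasFDerivAt E _ ξ :=
        ((((contDiff_gradSq hu).differentiable (by simp) ξ).hasFDerivAt.add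
          ((contDiff_gradSq hv).differentiable (by simp) ξ).hasFDerivAt).add
            (((hud ξ).hasFDerivAt.pow 2).mul ((hvd ξ).hasFDerivAt.pow 2)))
      rw [h3.fderiv, hlu, hlv]
      simp
      ring
    have hsum := congrArg₂ (· + ·) hru hrv
    beta_reduce at hsum
    rw [← integral_add (integrable_mul_wTwo (hc u hu)) (integrable_mul_wTwo (hc v hv))] at hsum
    have hEi := integrable_mul_wTwo (continuous_comp_affine hEsm.continuous x ρ)
    have hpi := integrable_mul_wTwo (continuous_comp_affine hpsm.continuous x ρ)
    have hri := integrable_mul_wTwo (continuous_radial hEsm x ρ)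
    have hEpi : Integrable fun y => 2 * (E (x + ρ • y) * wTwo y) -
        2 * (u (x + ρ • y) ^ 2 * v (x + ρ • y) ^ 2 * wTwo y) :=
      (hEi.const_mul 2).sub (hpi.const_mul 2)
    have hint : ∫ y, ((2 * gradSq u (x + ρ • y) + fderiv ℝ (gradSq u) (x + ρ • y) (ρ • y) +
          2 * (fderiv ℝ u (x + ρ • y) (ρ • y) * lap u (x + ρ • y))) * wTwo y +
        (2 * gradSq v (x + ρ • y) + fderiv ℝ (gradSq v) (x + ρ • y) (ρ • y) +
          2 * (fderiv ℝ v (x + ρ • y) (ρ • y) * lap v (x + ρ • y))) * wTwo y) =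
        2 * avTwo E x ρ - 2 * avTwo (fun y => u y ^ 2 * v y ^ 2) x ρ +
          ρ * ∫ y, fderiv ℝ E (x + ρ • y) y * wTwo y := by
      rw [avTwo, avTwo, ← integral_const_mul, ← integral_const_mul, ← integral_const_mul,
        ← integral_sub (hEi.const_mul 2) (hpi.const_mul 2),
        ← integral_add hEpi (hri.const_mul ρ)]
      refine integral_congr_ae (Filter.Eventually.of_forall fun y => ?_)
      have h5 : ρ * fderiv ℝ E (x + ρ • y) y = fderiv ℝ E (x + ρ • y) (ρ • y) := by
        rw [map_smul, smul_eq_mul]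
      simp only
      rw [← mul_assoc ρ, h5, hpt]
      simp only [hE]
      ring
    rw [hint] at hsum
    rw [hX]
    have h6 : avTwo E x ρ = ∫ y, E (x + ρ • y) * wTwo y := rfl
    rw [← h6]
    rw [eq_div_iff hρ.ne']
    norm_num
    linear_combination (ρ ^ 2 / 2) * hsum
  · intro ρ hρ
    have hCS : (∫ y, (u (x + ρ • y) * fderiv ℝ u (x + ρ • y) y +
        v (x + ρ • y) * fderiv ℝ v (x + ρ • y) y) * wOne y) ^ 2 ≤
        (∫ y, (fderiv ℝ u (x + ρ • y) y ^ 2 + fderiv ℝ v (x + ρ • y) y ^ 2) * wOne y) *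
          avOne (fun y => u y ^ 2 + v y ^ 2) x ρ := by
      refine sq_le_of_quadratic_nonneg (hpos ρ hρ) fun t => ?_
      have cu := continuous_comp_affine hu.continuous x ρ
      have cv := continuous_comp_affine hv.continuous x ρ
      have i1 : Integrable fun y => (fderiv ℝ u (x + ρ • y) y ^ 2 +
          fderiv ℝ v (x + ρ • y) y ^ 2) * wOne y := integrable_mul_wOne (((continuous_radial hu x ρ).pow 2).add
        ((continuous_radial hv x ρ).pow 2))
      have i2 : Integrable fun y => (u (x + ρ • y) * fderiv ℝ u (x + ρ • y) y +
          v (x + ρ • y) * fderiv ℝ v (x + ρ • y) y) * wOne y := integrable_mul_wOne ((cu.mul (continuous_radial hu x ρ)).add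
        (cv.mul (continuous_radial hv x ρ)))
      have i3 : Integrable fun y => (u (x + ρ • y) ^ 2 + v (x + ρ • y) ^ 2) * wOne y :=
        integrable_mul_wOne ((cu.pow 2).add (cv.pow 2))
      rw [avOne, ← integral_const_mul, ← integral_const_mul]
      have i4 : Integrable fun y => (fderiv ℝ u (x + ρ • y) y ^ 2 +
          fderiv ℝ v (x + ρ • y) y ^ 2) * wOne y - 2 * t * ((u (x + ρ • y) *
            fderiv ℝ u (x + ρ • y) y + v (x + ρ • y) * fderiv ℝ v (x + ρ • y) y) * wOne y) :=
        i1.sub (i2.const_mul _)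
      rw [← integral_sub i1 (i2.const_mul _), ← integral_add i4 (i3.const_mul _)]
      refine integral_nonneg fun y => ?_
      have : 0 ≤ ((fderiv ℝ u (x + ρ • y) y - t * u (x + ρ • y)) ^ 2 +
          (fderiv ℝ v (x + ρ • y) y - t * v (x + ρ • y)) ^ 2) * wOne y :=
        mul_nonneg (by positivity) (wOne_nonneg y)
      refine this.trans (le_of_eq ?_)
      ring
    have hY : ρ ^ 2 / 2 * avTwo E x ρ + ρ ^ 2 / 2 * avTwo (fun y => u y ^ 2 * v y ^ 2) x ρ =
        2 * ρ * ∫ y, (u (x + ρ • y) * fderiv ℝ u (x + ρ • y) y +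
          v (x + ρ • y) * fderiv ℝ v (x + ρ • y) y) * wOne y := by
      have h1 := integral_radial_eq hsm x ρ
      rw [funext hlap, avTwo_const_mul, avTwo_add hEsm.continuous hpsm.continuous] at h1
      have h2 : ∀ y, fderiv ℝ (fun y => u y ^ 2 + v y ^ 2) (x + ρ • y) y * wOne y =
          2 * ((u (x + ρ • y) * fderiv ℝ u (x + ρ • y) y +
            v (x + ρ • y) * fderiv ℝ v (x + ρ • y) y) * wOne y) := by
        intro y
        have h3 : HasFDerivAt (fun y => u y ^ 2 + v y ^ 2) _ (x + ρ • y) :=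
          ((hud (x + ρ • y)).hasFDerivAt.pow 2).add ((hvd (x + ρ • y)).hasFDerivAt.pow 2)
        rw [h3.fderiv]
        simp
        ring
      simp only [h2] at h1
      rw [integral_const_mul] at h1
      linear_combination (-ρ) * h1
    beta_reduce
    rw [hY]
    nlinarith [mul_le_mul_of_nonneg_left hCS (sq_nonneg (2 * ρ))]

/-! ### Consequences of the two-point principle -/

theorem IsSolution.swap {n : ℕ} {u v : EuclideanSpace ℝ (Fin n) → ℝ} (hsol : IsSolution u v) :
    IsSolution v u :=
  ⟨hsol.2.1, hsol.1, hsol.2.2.2.1, hsol.2.2.1, hsol.2.2.2.2.2, hsol.2.2.2.2.1⟩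

theorem IsSolution.lap_sq {n : ℕ} {u v : EuclideanSpace ℝ (Fin n) → ℝ} (hsol : IsSolution u v)
    (y : EuclideanSpace ℝ (Fin n)) :
    lap (fun y => u y ^ 2) y = 2 * (gradSq u y + u y ^ 2 * v y ^ 2) := by
  rw [_root_.lap_sq hsol.1, hsol.2.2.2.2.1]
  ring

theorem IsSolution.lap_sq_nonneg {n : ℕ} {u v : EuclideanSpace ℝ (Fin n) → ℝ}
    (hsol : IsSolution u v) (y : EuclideanSpace ℝ (Fin n)) : 0 ≤ lap (fun y => u y ^ 2) y := by
  rw [hsol.lap_sq]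
  have := gradSq_nonneg u y
  positivity

theorem IsSolution.contDiff_sq {n : ℕ} {u v : EuclideanSpace ℝ (Fin n) → ℝ}
    (hsol : IsSolution u v) : ContDiff ℝ (⊤ : ℕ∞) fun y => u y ^ 2 :=
  hsol.1.pow 2

theorem exists_mul_le {n : ℕ} (hn : 2 ≤ n) {u v : EuclideanSpace ℝ (Fin n) → ℝ}
    (hsol : IsSolution u v) {C₀ : ℝ} (hC₀ : 0 < C₀)
    (hgrowth : ∀ x, u x + v x ≤ C₀ * (1 + ‖x‖)) :
    ∃ A : ℝ, 0 < A ∧ ∀ y z, u y * v z ≤ A * (1 + ‖y - z‖) ^ 2 := by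
  have hn0 : (0 : ℝ) < n := by exact_mod_cast (by omega : 0 < n)
  refine ⟨15 * n ^ 2 * (9 * C₀ ^ 2 + 1), by positivity, fun y z => ?_⟩
  obtain ⟨ρ, hρdef⟩ : ∃ ρ, ρ = 1 + 2 * ‖y‖ + 2 * ‖z‖ := ⟨_, rfl⟩
  have hy0 := norm_nonneg y
  have hz0 := norm_nonneg z
  have hρ1 : 1 ≤ ρ := by linarith
  have hbd : ∀ w : EuclideanSpace ℝ (Fin n), ‖w - 0‖ ≤ 2 * ρ →
      u w ≤ C₀ * (1 + 2 * ρ) ∧ v w ≤ C₀ * (1 + 2 * ρ) := by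
    intro w hw
    rw [sub_zero] at hw
    have h1 := hgrowth w
    have h2 := hsol.2.2.1 w
    have h3 := hsol.2.2.2.1 w
    have h4 : C₀ * (1 + ‖w‖) ≤ C₀ * (1 + 2 * ρ) := by gcongr
    constructor <;> linarith
  have h := two_point_ball hn hsol (x := 0) (ρ := ρ) (l := 1) (S := (C₀ * (1 + 2 * ρ)) ^ 2)
    (y := y) (z := z) (by linarith) one_pos (fun y' z' hy' hz' => by
      rw [sq]
      exact mul_le_mul (hbd y' hy').1 (hbd z' hz').2 (hsol.2.2.2.1 z').le (by positivity))
    (by rw [sub_zero]; linarith) (by rw [sub_zero]; linarith)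
  refine h.trans ?_
  gcongr
  · rw [div_le_iff₀ (by positivity), mul_pow]
    have : (1 + 2 * ρ) ^ 2 ≤ 9 * ρ ^ 2 := by nlinarith
    nlinarith [sq_nonneg C₀]
  · norm_num

theorem exists_low {n : ℕ} (hn : 2 ≤ n) {u v : EuclideanSpace ℝ (Fin n) → ℝ}
    (hsol : IsSolution u v) : ∃ c : ℝ, 0 < c ∧ ∀ (x : EuclideanSpace ℝ (Fin n)) (R : ℝ), 0 < R →
      c * R ^ 4 * (u x * v x) ^ 4 ≤
        avOne (fun y => u y ^ 2) x R * avOne (fun y => v y ^ 2) x R := by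
  have hn0 : (0 : ℝ) < n := by exact_mod_cast (by omega : 0 < n)
  have hw := wMass_pos n
  obtain ⟨K, hKdef⟩ : ∃ K, K = 4 / 3 * (4 : ℝ) ^ n / wMass n := ⟨_, rfl⟩
  have hK : 0 < K := by rw [hKdef]; positivity
  refine ⟨1 / (900 ^ 2 * n ^ 8 * K ^ 2 * 8 ^ 4), by positivity, fun x R hR => ?_⟩
  obtain ⟨ρ, rfl⟩ : ∃ ρ, R = 8 * ρ := ⟨R / 8, by ring⟩
  have hρ : 0 < ρ := by linarith
  have key : ∀ {f g : EuclideanSpace ℝ (Fin n) → ℝ}, IsSolution f g → ∀ y, ‖y - x‖ ≤ 2 * ρ →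
      f y ^ 2 ≤ K * avOne (fun y => f y ^ 2) x (8 * ρ) := by
    intro f g hfg y hy
    have h1 := le_avOne hfg.contDiff_sq hfg.lap_sq_nonneg y (ρ := 2 * ρ) (by linarith)
    have h2 := avOne_le_of_subset hfg.contDiff_sq.continuous (fun _ => sq_nonneg _)
      (z := y) (x := x) (ρ := 2 * ρ) (R := 8 * ρ) (by linarith) (by linarith)
    rw [show 8 * ρ / (2 * ρ) = 4 by field_simp; norm_num] at h2
    rw [hKdef, div_mul_eq_mul_div, le_div_iff₀ hw]
    exact h1.trans h2
  have hux := hsol.2.2.1 x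
  have hvx := hsol.2.2.2.1 x
  obtain ⟨U, hU⟩ : ∃ U, U = avOne (fun y => u y ^ 2) x (8 * ρ) := ⟨_, rfl⟩
  obtain ⟨V, hV⟩ : ∃ V, V = avOne (fun y => v y ^ 2) x (8 * ρ) := ⟨_, rfl⟩
  have hku := key hsol
  have hkv := key hsol.swap
  rw [← hU] at hku
  rw [← hV] at hkv
  have hU0 : 0 < U := by
    have h1 : 0 < K * U := lt_of_lt_of_le (by positivity) (hku x (by simp; linarith))
    exact (mul_pos_iff_of_pos_left hK).1 h1
  have hV0 : 0 < V := by
    have h1 : 0 < K * V := lt_of_lt_of_le (by positivity) (hkv x (by simp; linarith))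
    exact (mul_pos_iff_of_pos_left hK).1 h1
  rw [← hU, ← hV]
  obtain ⟨S, hSdef⟩ : ∃ S, S = K * √(U * V) := ⟨_, rfl⟩
  have hS0 : 0 < S := by rw [hSdef]; positivity
  have hS2 : S ^ 2 = K ^ 2 * (U * V) := by
    rw [hSdef, mul_pow, Real.sq_sqrt (by positivity)]
  have hSb : ∀ y z, ‖y - x‖ ≤ 2 * ρ → ‖z - x‖ ≤ 2 * ρ → u y * v z ≤ S := by
    intro y z hy hz
    refine le_of_sq_le_sq ?_ hS0.le
    rw [hS2, mul_pow]
    calc u y ^ 2 * v z ^ 2 ≤ (K * U) * (K * V) :=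
          mul_le_mul (hku y hy) (hkv z hz) (sq_nonneg _) (by positivity)
      _ = _ := by ring
  obtain ⟨q, hq⟩ : ∃ q, q = √(ρ ^ 2 / S) := ⟨_, rfl⟩
  have hq0 : 0 < q := by rw [hq]; positivity
  have hq2 : q ^ 2 = ρ ^ 2 / S := by rw [hq, Real.sq_sqrt (by positivity)]
  have hl2 : √q ^ 2 = q := Real.sq_sqrt hq0.le
  have h := two_point_ball hn hsol (x := x) (ρ := ρ) (l := √q) (S := S) (y := x) (z := x) hρ
    (Real.sqrt_pos.2 hq0) hSb (by simp; linarith) (by simp; linarith)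
  have hl4 : √q ^ 4 = ρ ^ 2 / S := by
    rw [← hq2, ← hl2, ← pow_mul, hl2]
  have e1 : 1 / √q ^ 4 = S / ρ ^ 2 := by rw [hl4, one_div_div]
  rw [e1, sub_self, norm_zero, add_zero, hl2] at h
  have hT : u x * v x ≤ 30 * n ^ 2 * (S / ρ ^ 2 * q) := h.trans (le_of_eq (by ring))
  have h2 : (u x * v x) ^ 4 ≤ (30 * n ^ 2 * (S / ρ ^ 2 * q)) ^ 4 :=
    pow_le_pow_left₀ (by positivity) hT 4
  have h3 : (30 * n ^ 2 * (S / ρ ^ 2 * q)) ^ 4 = 900 ^ 2 * n ^ 8 * K ^ 2 * (U * V) / ρ ^ 4 := by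
    have : (30 * n ^ 2 * (S / ρ ^ 2 * q)) ^ 4 =
        900 ^ 2 * n ^ 8 * (S / ρ ^ 2) ^ 4 * (q ^ 2) ^ 2 := by ring
    rw [this, hq2, mul_assoc (_ * _) (K ^ 2), ← hS2]
    field_simp
  rw [h3, le_div_iff₀ (by positivity)] at h2
  rw [div_mul_eq_mul_div, div_mul_eq_mul_div, div_le_iff₀ (by positivity)]
  nlinarith [h2]

/-! ### Uniform bounds on the free boundary -/

theorem exists_avOne_le {n : ℕ} {u v : EuclideanSpace ℝ (Fin n) → ℝ} (hsol : IsSolution u v)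
    {C₀ : ℝ} (hC₀ : 0 < C₀) (hgrowth : ∀ x, u x + v x ≤ C₀ * (1 + ‖x‖))
    (x : EuclideanSpace ℝ (Fin n)) : ∃ C : ℝ, ∀ ρ, 1 ≤ ρ →
      avOne (fun y => u y ^ 2 + v y ^ 2) x ρ ≤ C * ρ ^ 2 := by
  refine ⟨(C₀ * (2 + ‖x‖)) ^ 2 * wMass n, fun ρ hρ => ?_⟩
  have hc : Continuous fun y => u y ^ 2 + v y ^ 2 :=
    (hsol.1.continuous.pow 2).add (hsol.2.1.continuous.pow 2)
  have hx := norm_nonneg x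
  have h := avOne_mono_fun (g := fun _ => (C₀ * (2 + ‖x‖) * ρ) ^ 2) hc continuous_const
    (by linarith : (0 : ℝ) ≤ ρ) (x := x) (fun y hy => by
      have h1 := hsol.2.2.1 y
      have h2 := hsol.2.2.2.1 y
      have h3 : ‖y‖ ≤ ρ + ‖x‖ := by
        have := norm_add_le (y - x) x
        rw [sub_add_cancel] at this
        linarith
      have h4 : C₀ * (1 + ‖y‖) ≤ C₀ * (2 + ‖x‖) * ρ := by
        rw [mul_assoc]
        gcongr
        nlinarith
      have h5 := pow_le_pow_left₀ (by linarith) ((hgrowth y).trans h4) 2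
      nlinarith)
  rw [avOne_const] at h
  exact h.trans (le_of_eq (by ring))

theorem harnack {n : ℕ} {u v : EuclideanSpace ℝ (Fin n) → ℝ} (hsol : IsSolution u v)
    {x y : EuclideanSpace ℝ (Fin n)} {K : ℝ} (hK : ∀ z, ‖z - x‖ ≤ 4 → u z ≤ K)
    (hy : ‖y - x‖ ≤ 1) : v y ≤ 4 / 3 * 4 ^ n * Real.exp (2 * K ^ 2) * v x := by
  have h1 := le_avOne hsol.2.1 (fun z => by
    rw [hsol.2.2.2.2.2]
    have := hsol.2.2.2.1 z
    positivity) y (ρ := 1) zero_le_one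
  have h2 := avOne_le_of_subset hsol.2.1.continuous (fun z => (hsol.2.2.2.1 z).le) (z := y)
    (x := x) (ρ := 1) (R := 4) one_pos (by linarith)
  have h3 := avOne_le_exp_mul hsol.2.1 (fun z => (hsol.2.2.2.1 z).le) (x := x) (ρ := 4)
    (K := K ^ 2) (by norm_num) (sq_nonneg _) (fun z hz => by
      rw [hsol.2.2.2.2.2, mul_comm]
      have := hK z hz
      have := hsol.2.2.1 z
      have := hsol.2.2.2.1 z
      gcongr)
  have hw := wMass_pos n
  rw [show K ^ 2 * 4 ^ 2 / 8 = 2 * K ^ 2 by ring] at h3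
  refine le_of_mul_le_mul_right ?_ hw
  calc v y * wMass n ≤ 4 / 3 * (4 / 1) ^ n * avOne v x 4 := h1.trans h2
    _ ≤ 4 / 3 * (4 / 1) ^ n * (Real.exp (2 * K ^ 2) * (v x * wMass n)) := by gcongr
    _ = _ := by rw [div_one]; ring

theorem exists_le_avOne_one {n : ℕ} (hn : 2 ≤ n) {u v : EuclideanSpace ℝ (Fin n) → ℝ}
    (hsol : IsSolution u v) {C₀ : ℝ} (hC₀ : 0 < C₀)
    (hgrowth : ∀ x, u x + v x ≤ C₀ * (1 + ‖x‖)) :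
    ∃ c : ℝ, 0 < c ∧ ∀ x, c ≤ avOne (fun y => u y ^ 2 + v y ^ 2) x 1 := by
  obtain ⟨c, hc, hlow⟩ := exists_low hn hsol
  have hu0 := hsol.2.2.1 0
  have hv0 := hsol.2.2.2.1 0
  refine ⟨2 * √c * (u 0 * v 0) ^ 2 / (4 / 3 * 4 ^ n * (Real.exp 1 * 16)), by positivity,
    fun x => ?_⟩
  obtain ⟨R, hRdef⟩ : ∃ R, R = max ‖x‖ 1 := ⟨_, rfl⟩
  have hRx : ‖x‖ ≤ R := hRdef ▸ le_max_left _ _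
  have hR1 : 1 ≤ R := hRdef ▸ le_max_right _ _
  have hcu := hsol.contDiff_sq.continuous
  have hcv := hsol.swap.contDiff_sq.continuous
  obtain ⟨C, hC⟩ := exists_avOne_le hsol hC₀ hgrowth x
  have h1 := almgren_growth hsol hC (R := 4 * R) (by linarith)
  have h2 := avOne_le_of_subset (f := fun y => u y ^ 2 + v y ^ 2) (hcu.add hcv)
    (fun _ => add_nonneg (sq_nonneg _) (sq_nonneg _))
    (z := 0) (x := x) (ρ := R) (R := 4 * R) (by linarith) (by
      rw [zero_sub, norm_neg]; linarith)
  have h3 := hlow 0 R (by linarith)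
  have h4 := avOne_add hcu hcv 0 R
  have hU := avOne_nonneg (f := fun y => u y ^ 2) (fun _ => sq_nonneg _) 0 R
  have hV := avOne_nonneg (f := fun y => v y ^ 2) (fun _ => sq_nonneg _) 0 R
  have h5 : 2 * √c * (u 0 * v 0) ^ 2 * R ^ 2 ≤ avOne (fun y => u y ^ 2 + v y ^ 2) 0 R := by
    rw [h4]
    refine le_of_sq_le_sq ?_ (by positivity)
    have : (2 * √c * (u 0 * v 0) ^ 2 * R ^ 2) ^ 2 = 4 * (c * R ^ 4 * (u 0 * v 0) ^ 4) := by
      rw [mul_pow, mul_pow, mul_pow, Real.sq_sqrt hc.le]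
      ring
    rw [this]
    nlinarith [sq_nonneg (avOne (fun y => u y ^ 2) 0 R - avOne (fun y => v y ^ 2) 0 R)]
  rw [div_le_iff₀ (by positivity)]
  have hR2 : 0 < R ^ 2 := by positivity
  refine le_of_mul_le_mul_right ?_ hR2
  rw [show 4 * R / R = 4 by field_simp] at h2
  calc _ ≤ 4 / 3 * (4 : ℝ) ^ n * avOne (fun y => u y ^ 2 + v y ^ 2) x (4 * R) := h5.trans h2
    _ ≤ 4 / 3 * (4 : ℝ) ^ n * (Real.exp 1 * (4 * R) ^ 2 *
        avOne (fun y => u y ^ 2 + v y ^ 2) x 1) := by gcongr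
    _ = _ := by ring

theorem exists_le_of_eq {n : ℕ} (hn : 2 ≤ n) {u v : EuclideanSpace ℝ (Fin n) → ℝ}
    (hsol : IsSolution u v) {C₀ : ℝ} (hC₀ : 0 < C₀)
    (hgrowth : ∀ x, u x + v x ≤ C₀ * (1 + ‖x‖)) :
    ∃ c : ℝ, 0 < c ∧ ∀ x, u x = v x → c ≤ u x := by
  obtain ⟨A, hA, hmul⟩ := exists_mul_le hn hsol hC₀ hgrowth
  obtain ⟨c, hc, hone⟩ := exists_le_avOne_one hn hsol hC₀ hgrowth
  have hw := wMass_pos n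
  obtain ⟨μ, hμdef⟩ : ∃ μ, μ = √(c / (4 * wMass n)) := ⟨_, rfl⟩
  have hμ : 0 < μ := by rw [hμdef]; positivity
  have hμ2 : μ ^ 2 = c / (4 * wMass n) := by rw [hμdef, Real.sq_sqrt (by positivity)]
  obtain ⟨L, hL⟩ : ∃ L, L = 4 / 3 * (4 : ℝ) ^ n * Real.exp (2 * (A * 36 / μ) ^ 2) := ⟨_, rfl⟩
  have hL0 : 0 < L := by rw [hL]; positivity
  have key : ∀ {f g : EuclideanSpace ℝ (Fin n) → ℝ}, IsSolution f g →
      (∀ y z, f y * g z ≤ A * (1 + ‖y - z‖) ^ 2) → ∀ x y, ‖y - x‖ ≤ 1 → μ ≤ g y →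
        μ / L ≤ g x := by
    intro f g hfg hm x y hy hgy
    rw [div_le_iff₀ hL0, mul_comm, hL]
    refine hgy.trans (harnack hfg (fun z hz => ?_) hy)
    rw [le_div_iff₀ hμ]
    have h1 := hm z y
    have h2 : ‖z - y‖ ≤ 5 := by
      have := norm_sub_le (z - x) (y - x)
      rw [sub_sub_sub_cancel_right] at this
      linarith
    have h3 : (1 + ‖z - y‖) ^ 2 ≤ 36 := by nlinarith [norm_nonneg (z - y)]
    have h4 := mul_le_mul_of_nonneg_left hgy (hfg.2.2.1 z).le
    nlinarith
  refine ⟨μ / L, by positivity, fun x hx => ?_⟩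
  obtain ⟨y, hy, hyμ⟩ : ∃ y, ‖y - x‖ ≤ 1 ∧ 2 * μ ^ 2 < u y ^ 2 + v y ^ 2 := by
    by_contra! hcon
    have hcont : Continuous fun y => u y ^ 2 + v y ^ 2 :=
      hsol.contDiff_sq.continuous.add hsol.swap.contDiff_sq.continuous
    have h1 := avOne_mono_fun (g := fun _ => 2 * μ ^ 2) hcont continuous_const zero_le_one hcon
    rw [avOne_const, hμ2] at h1
    have h2 := hone x
    have h3 : 2 * (c / (4 * wMass n)) * wMass n = c / 2 := by
      field_simp
      norm_num
    linarith
  rcases le_total μ (v y) with h | h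
  · rw [hx]
    exact key hsol hmul x y hy h
  · refine key hsol.swap (fun y z => ?_) x y hy ?_
    · rw [mul_comm, norm_sub_rev]
      exact hmul z y
    · have h1 := hsol.2.2.2.1 y
      refine le_of_sq_le_sq ?_ (hsol.2.2.1 y).le
      nlinarith

/-- All the uniform estimates at free boundary points. -/
theorem exists_uniform_bounds {n : ℕ} (hn : 2 ≤ n) {u v : EuclideanSpace ℝ (Fin n) → ℝ}
    (hsol : IsSolution u v) {C₀ : ℝ} (hC₀ : 0 < C₀)
    (hgrowth : ∀ x, u x + v x ≤ C₀ * (1 + ‖x‖)) :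
    ∃ B c D : ℝ, 0 < B ∧ 0 < c ∧ 0 < D ∧ ∀ x, u x = v x → c ≤ u x ∧
      (∀ z, ‖z - x‖ ≤ 5 → u z ≤ B ∧ v z ≤ B) ∧ ∀ R, 1 ≤ R →
        (avOne (fun y => u y ^ 2) x R ≤ D * R ^ 2 ∧ avOne (fun y => v y ^ 2) x R ≤ D * R ^ 2) ∧
        (c * R ^ 2 ≤ avOne (fun y => u y ^ 2) x R ∧
          c * R ^ 2 ≤ avOne (fun y => v y ^ 2) x R) := by
  obtain ⟨A, hA, hmul⟩ := exists_mul_le hn hsol hC₀ hgrowth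
  obtain ⟨c₁, hc₁, hlow⟩ := exists_low hn hsol
  obtain ⟨c₃, hc₃, hfree⟩ := exists_le_of_eq hn hsol hC₀ hgrowth
  have hw := wMass_pos n
  obtain ⟨B, hB⟩ : ∃ B, B = A * 36 / c₃ := ⟨_, rfl⟩
  have hB0 : 0 < B := by rw [hB]; positivity
  obtain ⟨D, hD⟩ : ∃ D, D = Real.exp 1 * (2 * B ^ 2 * wMass n) := ⟨_, rfl⟩
  have hD0 : 0 < D := by rw [hD]; positivity
  refine ⟨B, min c₃ (c₁ * c₃ ^ 8 / D), D, hB0, by positivity, hD0, fun x hx => ?_⟩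
  have hux := hfree x hx
  have hvx : c₃ ≤ v x := hx ▸ hux
  have hbd : ∀ z, ‖z - x‖ ≤ 5 → u z ≤ B ∧ v z ≤ B := by
    intro z hz
    have h3 : (1 + ‖z - x‖) ^ 2 ≤ 36 := by nlinarith [norm_nonneg (z - x)]
    have h1 := hmul z x
    have h2 := hmul x z
    rw [norm_sub_rev] at h2
    have h4 := mul_le_mul_of_nonneg_left hvx (hsol.2.2.1 z).le
    have h5 := mul_le_mul_of_nonneg_left hux (hsol.2.2.2.1 z).le
    rw [hB, le_div_iff₀ hc₃, le_div_iff₀ hc₃]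
    constructor <;> nlinarith
  refine ⟨(min_le_left _ _).trans hux, hbd, fun R hR => ?_⟩
  have hR0 : 0 < R := by linarith
  have hcu := hsol.contDiff_sq.continuous
  have hcv := hsol.swap.contDiff_sq.continuous
  obtain ⟨C, hC⟩ := exists_avOne_le hsol hC₀ hgrowth x
  have h1 := almgren_growth hsol hC hR
  have h2 : avOne (fun y => u y ^ 2 + v y ^ 2) x 1 ≤ 2 * B ^ 2 * wMass n := by
    rw [← avOne_const]
    refine avOne_mono_fun (f := fun y => u y ^ 2 + v y ^ 2) (hcu.add hcv) continuous_const zero_le_one fun y hy => ?_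
    have h3 := hbd y (by linarith)
    have h4 := pow_le_pow_left₀ (hsol.2.2.1 y).le h3.1 2
    have h5 := pow_le_pow_left₀ (hsol.2.2.2.1 y).le h3.2 2
    linarith
  have h3 : avOne (fun y => u y ^ 2 + v y ^ 2) x R ≤ D * R ^ 2 := by
    refine h1.trans ?_
    rw [hD, mul_right_comm]
    gcongr
  rw [avOne_add hcu hcv] at h3
  have hU := avOne_nonneg (f := fun y => u y ^ 2) (fun _ => sq_nonneg _) x R
  have hV := avOne_nonneg (f := fun y => v y ^ 2) (fun _ => sq_nonneg _) x R
  have h4 := hlow x R hR0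
  have h5 : c₁ * R ^ 4 * c₃ ^ 8 ≤ c₁ * R ^ 4 * (u x * v x) ^ 4 := by
    have : c₃ ^ 8 = (c₃ * c₃) ^ 4 := by ring
    rw [this]
    have := hsol.2.2.1 x
    gcongr
  have h6 : ∀ P Q : ℝ, 0 ≤ P → Q ≤ D * R ^ 2 → c₁ * R ^ 4 * c₃ ^ 8 ≤ P * Q →
      min c₃ (c₁ * c₃ ^ 8 / D) * R ^ 2 ≤ P := by
    intro P Q hP hQ hPQ
    have h7 : c₁ * R ^ 4 * c₃ ^ 8 ≤ P * (D * R ^ 2) :=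
      hPQ.trans (mul_le_mul_of_nonneg_left hQ hP)
    have h8 : c₁ * c₃ ^ 8 / D * R ^ 2 ≤ P := by
      rw [div_mul_eq_mul_div, div_le_iff₀ hD0]
      refine le_of_mul_le_mul_right ?_ (by positivity : 0 < R ^ 2)
      linarith
    refine le_trans ?_ h8
    gcongr
    exact min_le_right _ _
  refine ⟨⟨by linarith, by linarith⟩, h6 _ _ hU (by linarith) (h5.trans h4),
    h6 _ _ hV (by linarith) (h5.trans (h4.trans (le_of_eq (mul_comm _ _))))⟩

/-! ### The singular integrals -/

/-- The singular integral `∫_{B_r(x)} e(y) |x-y|^{2-n} dy`. -/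
def rieszInt {n : ℕ} (e : EuclideanSpace ℝ (Fin n) → ℝ) (x : EuclideanSpace ℝ (Fin n))
    (r : ℝ) : ℝ :=
  ∫ y in ball x r, e y * ‖x - y‖ ^ ((2 : ℝ) - n)

theorem le_lintegral_kernel {n : ℕ} {x y : EuclideanSpace ℝ (Fin n)} {r a : ℝ} (hxy : y ≠ x)
    (hy : y ∈ ball x r) (ha : 0 ≤ a) :
    ENNReal.ofReal (9 / 8 * ((4 : ℝ) ^ n)⁻¹ * (a * ‖x - y‖ ^ ((2 : ℝ) - n))) ≤
      ∫⁻ ρ in Set.Ioc 0 (4 * r),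
        ENNReal.ofReal (ρ / 2 * ((ρ ^ n)⁻¹ * (a * wTwo (ρ⁻¹ • (y - x))))) := by
  obtain ⟨s, hs⟩ : ∃ s, s = ‖y - x‖ := ⟨_, rfl⟩
  have hs0 : 0 < s := by rw [hs]; exact norm_pos_iff.2 (sub_ne_zero.2 hxy)
  have hsr : s < r := by rw [hs, ← dist_eq_norm]; exact hy
  have e1 : 9 / 8 * ((4 : ℝ) ^ n)⁻¹ * (a * ‖x - y‖ ^ ((2 : ℝ) - n)) =
      s * (((4 * s) ^ n)⁻¹ * (a * (9 / 16))) * (4 * s - 2 * s) := by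
    rw [norm_sub_rev, ← hs, Real.rpow_sub hs0, Real.rpow_two, Real.rpow_natCast, mul_pow]
    field_simp
    ring
  calc _ = ∫⁻ _ in Set.Ioc (2 * s) (4 * s),
        ENNReal.ofReal (s * (((4 * s) ^ n)⁻¹ * (a * (9 / 16)))) := by
        rw [setLIntegral_const, Real.volume_Ioc, ← ENNReal.ofReal_mul (by positivity), e1]
    _ ≤ ∫⁻ ρ in Set.Ioc (2 * s) (4 * s),
        ENNReal.ofReal (ρ / 2 * ((ρ ^ n)⁻¹ * (a * wTwo (ρ⁻¹ • (y - x))))) := by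
        refine setLIntegral_mono' measurableSet_Ioc fun ρ hρ => ENNReal.ofReal_le_ofReal ?_
        have h1 : 2 * s < ρ := hρ.1
        have h2 : ρ ≤ 4 * s := hρ.2
        have hρ0 : 0 < ρ := by linarith
        have h3 : 9 / 16 ≤ wTwo (ρ⁻¹ • (y - x)) := by
          have h4 : ‖ρ⁻¹ • (y - x)‖ ≤ 1 / 2 := by
            rw [norm_smul, Real.norm_eq_abs, abs_of_pos (inv_pos.2 hρ0), ← hs,
              inv_mul_le_iff₀ hρ0]
            linarith
          have h5 : 3 / 4 ≤ wOne (ρ⁻¹ • (y - x)) :=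
            le_trans (by nlinarith [norm_nonneg (ρ⁻¹ • (y - x))]) (le_max_left _ _)
          rw [wTwo]
          nlinarith [wOne_nonneg (ρ⁻¹ • (y - x))]
        gcongr
        linarith
    _ ≤ _ := lintegral_mono_set (Set.Ioc_subset_Ioc (by linarith) (by linarith))

theorem hasDerivAt_avOne_of_lap {n : ℕ} {f e : EuclideanSpace ℝ (Fin n) → ℝ}
    (hf : ContDiff ℝ (⊤ : ℕ∞) f) (hlap : ∀ y, lap f y = 2 * e y)
    (x : EuclideanSpace ℝ (Fin n)) (ρ : ℝ) :
    HasDerivAt (avOne f x) (ρ / 2 * avTwo e x ρ) ρ := by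
  refine (hasDerivAt_avOne hf x ρ).congr_deriv ?_
  rw [funext hlap, avTwo_const_mul]
  ring

theorem integrable_mul_wTwo_dilate {n : ℕ} {e : EuclideanSpace ℝ (Fin n) → ℝ}
    (he : Continuous e) (x : EuclideanSpace ℝ (Fin n)) {ρ : ℝ} (hρ : 0 < ρ) :
    Integrable fun y => e y * wTwo (ρ⁻¹ • (y - x)) := by
  refine Continuous.integrable_of_hasCompactSupport
    (he.mul (continuous_wTwo.comp (by fun_prop))) ?_
  refine HasCompactSupport.intro (isCompact_closedBall x ρ) fun y hy => ?_
  have h1 : ρ < ‖y - x‖ := by simpa [dist_eq_norm] using hy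
  rw [wTwo_eq_zero, mul_zero]
  rw [norm_smul, Real.norm_eq_abs, abs_of_pos (inv_pos.2 hρ), le_inv_mul_iff₀ hρ]
  linarith

theorem lintegral_riesz_le {n : ℕ} (hn : 2 ≤ n) {f e : EuclideanSpace ℝ (Fin n) → ℝ}
    (hf : ContDiff ℝ (⊤ : ℕ∞) f) (he : ContDiff ℝ (⊤ : ℕ∞) e) (he0 : ∀ y, 0 ≤ e y)
    (hlap : ∀ y, lap f y = 2 * e y) (x : EuclideanSpace ℝ (Fin n)) {r : ℝ} (hr : 0 < r) :
    ∫⁻ y in ball x r, ENNReal.ofReal (9 / 8 * ((4 : ℝ) ^ n)⁻¹ *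
      (e y * ‖x - y‖ ^ ((2 : ℝ) - n))) ≤
      ENNReal.ofReal (avOne f x (4 * r) - avOne f x 0) := by
  have hder := hasDerivAt_avOne_of_lap hf hlap x
  have hcont : Continuous fun ρ : ℝ => ρ / 2 * avTwo e x ρ := by
    have h1 : Continuous (avTwo e x) := continuous_iff_continuousAt.2 fun ρ =>
      (hasDerivAt_weighted_mean he continuous_wTwo (fun _ => wTwo_eq_zero) x ρ).continuousAt
    fun_prop
  have hr4 : (0 : ℝ) ≤ 4 * r := by linarith
  have hftc : avOne f x (4 * r) - avOne f x 0 =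
      ∫ ρ in Set.Ioc 0 (4 * r), ρ / 2 * avTwo e x ρ := by
    rw [← intervalIntegral.integral_of_le hr4,
      intervalIntegral.integral_eq_sub_of_hasDerivAt (fun ρ _ => hder ρ)
        (hcont.intervalIntegrable _ _)]
  have hmeas : Measurable fun p : ℝ × EuclideanSpace ℝ (Fin n) =>
      ENNReal.ofReal (p.1 / 2 * ((p.1 ^ n)⁻¹ * (e p.2 * wTwo (p.1⁻¹ • (p.2 - x))))) := by
    have h1 : Measurable e := he.continuous.measurable
    have h2 : Measurable (wTwo : EuclideanSpace ℝ (Fin n) → ℝ) := continuous_wTwo.measurable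
    fun_prop
  have hnull : ∀ᵐ y ∂(volume : Measure (EuclideanSpace ℝ (Fin n))), y ≠ x := by
    have : Nonempty (Fin n) := ⟨⟨0, by omega⟩⟩
    exact compl_mem_ae_iff.2 (measure_singleton x)
  calc _ ≤ ∫⁻ y in ball x r, ∫⁻ ρ in Set.Ioc 0 (4 * r),
        ENNReal.ofReal (ρ / 2 * ((ρ ^ n)⁻¹ * (e y * wTwo (ρ⁻¹ • (y - x))))) := by
        refine setLIntegral_mono_ae' measurableSet_ball ?_
        filter_upwards [hnull] with y hy hyr
        exact le_lintegral_kernel hy hyr (he0 y)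
    _ ≤ ∫⁻ y, ∫⁻ ρ in Set.Ioc 0 (4 * r),
        ENNReal.ofReal (ρ / 2 * ((ρ ^ n)⁻¹ * (e y * wTwo (ρ⁻¹ • (y - x))))) :=
        setLIntegral_le_lintegral _ _
    _ = ∫⁻ ρ in Set.Ioc 0 (4 * r), ∫⁻ y,
        ENNReal.ofReal (ρ / 2 * ((ρ ^ n)⁻¹ * (e y * wTwo (ρ⁻¹ • (y - x))))) :=
        (lintegral_lintegral_swap hmeas.aemeasurable).symm
    _ = ∫⁻ ρ in Set.Ioc 0 (4 * r), ENNReal.ofReal (ρ / 2 * avTwo e x ρ) := by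
        refine setLIntegral_congr_fun measurableSet_Ioc fun ρ hρ => ?_
        have hρ0 : 0 < ρ := hρ.1
        have hi := ((integrable_mul_wTwo_dilate he.continuous x hρ0).const_mul
          (ρ ^ n)⁻¹).const_mul (ρ / 2)
        rw [← ofReal_integral_eq_lintegral_ofReal hi (Filter.Eventually.of_forall fun y => ?_),
          integral_const_mul, integral_const_mul, avTwo, integral_comp_affine _ _ _ hρ0]
        have := he0 y
        have := wTwo_nonneg (ρ⁻¹ • (y - x))
        simp only [Pi.zero_apply]
        positivity
    _ = _ := by
        rw [hftc, ofReal_integral_eq_lintegral_ofReal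
          (hcont.integrableOn_Ioc)]
        refine (ae_restrict_iff' measurableSet_Ioc).2 (Filter.Eventually.of_forall fun ρ hρ => ?_)
        exact mul_nonneg (by linarith [hρ.1]) (avTwo_nonneg he0 x ρ)

theorem integrableOn_const_mul_riesz {n : ℕ} (hn : 2 ≤ n) {f e : EuclideanSpace ℝ (Fin n) → ℝ}
    (hf : ContDiff ℝ (⊤ : ℕ∞) f) (he : ContDiff ℝ (⊤ : ℕ∞) e) (he0 : ∀ y, 0 ≤ e y)
    (hlap : ∀ y, lap f y = 2 * e y) (x : EuclideanSpace ℝ (Fin n)) {r : ℝ} (hr : 0 < r) :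
    IntegrableOn (fun y => 9 / 8 * ((4 : ℝ) ^ n)⁻¹ * (e y * ‖x - y‖ ^ ((2 : ℝ) - n)))
      (ball x r) := by
  refine ⟨?_, ?_⟩
  · have h1 : Measurable e := he.continuous.measurable
    exact Measurable.aestronglyMeasurable (by fun_prop)
  · rw [hasFiniteIntegral_iff_ofReal (Filter.Eventually.of_forall fun y => ?_)]
    · exact (lintegral_riesz_le hn hf he he0 hlap x hr).trans_lt ENNReal.ofReal_lt_top
    · have := he0 y
      simp only [Pi.zero_apply]
      positivity

theorem rieszInt_le {n : ℕ} (hn : 2 ≤ n) {f e : EuclideanSpace ℝ (Fin n) → ℝ}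
    (hf : ContDiff ℝ (⊤ : ℕ∞) f) (hf0 : ∀ y, 0 ≤ f y) (he : ContDiff ℝ (⊤ : ℕ∞) e)
    (he0 : ∀ y, 0 ≤ e y) (hlap : ∀ y, lap f y = 2 * e y) (x : EuclideanSpace ℝ (Fin n)) {r : ℝ}
    (hr : 0 < r) : rieszInt e x r ≤ 4 ^ n * avOne f x (4 * r) := by
  have hi := integrableOn_const_mul_riesz hn hf he he0 hlap x hr
  have h1 := lintegral_riesz_le hn hf he he0 hlap x hr
  have hmono := avOne_mono hf (fun y => by rw [hlap]; linarith [he0 y]) x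
    (Set.mem_Ici.2 le_rfl) (Set.mem_Ici.2 (by linarith : (0 : ℝ) ≤ 4 * r)) (by linarith)
  rw [← ofReal_integral_eq_lintegral_ofReal hi (Filter.Eventually.of_forall fun y => by
    have := he0 y
    simp only [Pi.zero_apply]
    positivity), ENNReal.ofReal_le_ofReal_iff (by linarith), integral_const_mul] at h1
  change 9 / 8 * ((4 : ℝ) ^ n)⁻¹ * rieszInt e x r ≤ _ at h1
  have h2 := avOne_nonneg hf0 x 0
  have h4 : (0 : ℝ) < 4 ^ n := by positivity
  have h5 : rieszInt e x r = 8 / 9 * 4 ^ n * (9 / 8 * ((4 : ℝ) ^ n)⁻¹ * rieszInt e x r) := by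
    field_simp
  have h6 := avOne_nonneg hf0 x (4 * r)
  rw [h5]
  calc _ ≤ 8 / 9 * 4 ^ n * (avOne f x (4 * r) - avOne f x 0) := by gcongr
    _ ≤ 4 ^ n * avOne f x (4 * r) := by nlinarith

theorem integrableOn_riesz {n : ℕ} (hn : 2 ≤ n) {f e : EuclideanSpace ℝ (Fin n) → ℝ}
    (hf : ContDiff ℝ (⊤ : ℕ∞) f) (he : ContDiff ℝ (⊤ : ℕ∞) e) (he0 : ∀ y, 0 ≤ e y)
    (hlap : ∀ y, lap f y = 2 * e y) (x : EuclideanSpace ℝ (Fin n)) {r : ℝ} (hr : 0 < r) :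
    IntegrableOn (fun y => e y * ‖x - y‖ ^ ((2 : ℝ) - n)) (ball x r) := by
  have hi := (integrableOn_const_mul_riesz hn hf he he0 hlap x hr).const_mul (8 / 9 * 4 ^ n)
  refine hi.congr (Filter.Eventually.of_forall fun y => ?_)
  field_simp

theorem setIntegral_ball_le_rieszInt {n : ℕ} (hn : 2 ≤ n)
    {e : EuclideanSpace ℝ (Fin n) → ℝ} (he : Continuous e) (he0 : ∀ y, 0 ≤ e y)
    {x : EuclideanSpace ℝ (Fin n)} {r : ℝ} (hr : 0 < r)
    (hi : IntegrableOn (fun y => e y * ‖x - y‖ ^ ((2 : ℝ) - n)) (ball x r)) :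
    ∫ y in ball x r, e y ≤ r ^ n / r ^ 2 * rieszInt e x r := by
  have hnull : ∀ᵐ y ∂(volume : Measure (EuclideanSpace ℝ (Fin n))), y ≠ x := by
    have : Nonempty (Fin n) := ⟨⟨0, by omega⟩⟩
    exact compl_mem_ae_iff.2 (measure_singleton x)
  rw [rieszInt, ← integral_const_mul]
  refine setIntegral_mono_on_ae ?_ (hi.const_mul _) measurableSet_ball ?_
  · exact (he.continuousOn.integrableOn_compact (isCompact_closedBall x r)).mono_set
      ball_subset_closedBall
  · filter_upwards [hnull] with y hy hyr
    have hs0 : 0 < ‖x - y‖ := norm_pos_iff.2 (sub_ne_zero.2 hy.symm)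
    have hsr : ‖x - y‖ ≤ r := by
      rw [← dist_eq_norm, dist_comm]
      exact (mem_ball.1 hyr).le
    have hn2 : (2 : ℝ) - n ≤ 0 := by
      have : (2 : ℝ) ≤ n := by exact_mod_cast hn
      linarith
    have h1 := Real.rpow_le_rpow_of_nonpos hs0 hsr hn2
    rw [Real.rpow_sub hr, Real.rpow_two, Real.rpow_natCast] at h1
    have h2 : 1 ≤ r ^ n / r ^ 2 * ‖x - y‖ ^ ((2 : ℝ) - n) := by
      calc 1 = r ^ n / r ^ 2 * (r ^ 2 / r ^ n) := by field_simp
        _ ≤ _ := by gcongr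
    nlinarith [he0 y]

theorem avOne_sub_le_rieszInt {n : ℕ} (hn : 2 ≤ n) {f e : EuclideanSpace ℝ (Fin n) → ℝ}
    (hf : ContDiff ℝ (⊤ : ℕ∞) f) (he : ContDiff ℝ (⊤ : ℕ∞) e) (he0 : ∀ y, 0 ≤ e y)
    (hlap : ∀ y, lap f y = 2 * e y) (x : EuclideanSpace ℝ (Fin n)) {r θ : ℝ} (hr : 0 < r)
    (hθ : 0 < θ) (hθ1 : θ ≤ 1) :
    avOne f x r - avOne f x (θ * r) ≤ rieszInt e x r / (2 * θ ^ n) := by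
  have hi := integrableOn_riesz hn hf he he0 hlap x hr
  have hint := setIntegral_ball_le_rieszInt hn he.continuous he0 hr hi
  have hder := hasDerivAt_avOne_of_lap hf hlap x
  have hI0 : 0 ≤ rieszInt e x r := integral_nonneg fun y => mul_nonneg (he0 y) (by positivity)
  have hθr : 0 < θ * r := by positivity
  have hθr1 : θ * r ≤ r := by nlinarith
  have heint : IntegrableOn e (ball x r) :=
    (he.continuous.continuousOn.integrableOn_compact (isCompact_closedBall x r)).mono_set
      ball_subset_closedBall
  have h := (convex_Icc (θ * r) r).image_sub_le_mul_sub_of_deriv_le (f := avOne f x)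
    (C := rieszInt e x r / (2 * θ ^ n * r))
    (fun ρ _ => (hder ρ).continuousAt.continuousWithinAt)
    (fun ρ _ => (hder ρ).differentiableAt.differentiableWithinAt) (fun ρ hρ => by
      have hρ' := interior_subset hρ
      have hρ0 : 0 < ρ := hθr.trans_le hρ'.1
      have hw : ∫ y, e y * wTwo (ρ⁻¹ • (y - x)) ≤ ∫ y in ball x r, e y := by
        rw [← setIntegral_eq_integral_of_forall_compl_eq_zero (s := ball x r)]
        · refine setIntegral_mono_on
            (integrable_mul_wTwo_dilate he.continuous x hρ0).integrableOn heint
            measurableSet_ball fun y _ => ?_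
          exact mul_le_of_le_one_right (he0 y) ((wTwo_le_wOne _).trans (wOne_le_one _))
        · intro y hy
          have h1 : r ≤ ‖y - x‖ := by simpa [dist_eq_norm] using hy
          rw [wTwo_eq_zero, mul_zero]
          rw [norm_smul, Real.norm_eq_abs, abs_of_pos (inv_pos.2 hρ0), le_inv_mul_iff₀ hρ0]
          linarith [hρ'.2]
      have hE0 : 0 ≤ ∫ y in ball x r, e y := integral_nonneg he0
      have hE1 : 0 ≤ ∫ y, e y * wTwo (ρ⁻¹ • (y - x)) :=
        integral_nonneg fun y => mul_nonneg (he0 y) (wTwo_nonneg _)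
      rw [(hder ρ).deriv, avTwo, integral_comp_affine _ _ _ hρ0]
      calc ρ / 2 * ((ρ ^ n)⁻¹ * ∫ y, e y * wTwo (ρ⁻¹ • (y - x))) ≤
          r / 2 * (((θ * r) ^ n)⁻¹ * ∫ y in ball x r, e y) := by
            gcongr
            · exact hρ'.2
            · exact hρ'.1
        _ ≤ r / 2 * (((θ * r) ^ n)⁻¹ * (r ^ n / r ^ 2 * rieszInt e x r)) := by gcongr
        _ = _ := by
            rw [mul_pow]
            field_simp) _ (Set.left_mem_Icc.2 hθr1) _ (Set.right_mem_Icc.2 hθr1) hθr1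
  refine h.trans ?_
  calc rieszInt e x r / (2 * θ ^ n * r) * (r - θ * r) ≤ rieszInt e x r / (2 * θ ^ n * r) * r := by
        gcongr
        linarith
    _ = _ := by field_simp

theorem mul_volume_le_rieszInt {n : ℕ} (hn : 2 ≤ n) {e : EuclideanSpace ℝ (Fin n) → ℝ}
    (he : Continuous e) (he0 : ∀ y, 0 ≤ e y) {x : EuclideanSpace ℝ (Fin n)} {r b : ℝ}
    (hr : 1 ≤ r) (hi : IntegrableOn (fun y => e y * ‖x - y‖ ^ ((2 : ℝ) - n)) (ball x r))
    (hb : ∀ y ∈ ball x 1, b ≤ e y) :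
    b * volume.real (ball (0 : EuclideanSpace ℝ (Fin n)) 1) ≤ rieszInt e x r := by
  have hi1 := hi.mono_set (ball_subset_ball hr)
  have h1 := setIntegral_ball_le_rieszInt hn he he0 one_pos hi1
  have h2 : rieszInt e x 1 ≤ rieszInt e x r :=
    setIntegral_mono_set hi (Filter.Eventually.of_forall fun y =>
      mul_nonneg (he0 y) (by positivity)) (ball_subset_ball hr).eventuallyLE
  have heint : IntegrableOn e (ball x 1) :=
    (he.continuousOn.integrableOn_compact (isCompact_closedBall x 1)).mono_set
      ball_subset_closedBall
  have h3 : b * volume.real (ball x 1) ≤ ∫ y in ball x 1, e y := by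
    have := setIntegral_mono_on (integrableOn_const measure_ball_lt_top.ne) heint
      measurableSet_ball hb
    rw [setIntegral_const, smul_eq_mul, mul_comm] at this
    exact this
  have h4 : volume.real (ball x 1) = volume.real (ball (0 : EuclideanSpace ℝ (Fin n)) 1) := by
    rw [measureReal_def, measureReal_def, Measure.addHaar_ball_center]
  rw [h4] at h3
  simp only [one_pow, div_one, one_mul] at h1
  linarith

theorem le_rieszInt {n : ℕ} (hn : 2 ≤ n) {f e : EuclideanSpace ℝ (Fin n) → ℝ}
    (hf : ContDiff ℝ (⊤ : ℕ∞) f) (he : ContDiff ℝ (⊤ : ℕ∞) e) (he0 : ∀ y, 0 ≤ e y)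
    (hlap : ∀ y, lap f y = 2 * e y) {x : EuclideanSpace ℝ (Fin n)} {c D b r : ℝ} (hc : 0 < c)
    (hD : 0 < D) (hb0 : 0 < b) (hlow : ∀ R, 1 ≤ R → c * R ^ 2 ≤ avOne f x R)
    (hup : ∀ R, 1 ≤ R → avOne f x R ≤ D * R ^ 2) (hb : ∀ y ∈ ball x 1, b ≤ e y) (hr : 1 ≤ r) :
    min (√(c / (2 * D)) ^ n * c)
      (b * volume.real (ball (0 : EuclideanSpace ℝ (Fin n)) 1) * (c / (2 * D))) * r ^ 2 ≤
        rieszInt e x r := by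
  obtain ⟨θ, hθdef⟩ : ∃ θ, θ = √(c / (2 * D)) := ⟨_, rfl⟩
  have hθ : 0 < θ := by rw [hθdef]; positivity
  have hθ2 : θ ^ 2 = c / (2 * D) := by rw [hθdef, Real.sq_sqrt (by positivity)]
  have hcD : c ≤ D := by
    have h1 := (hlow 1 le_rfl).trans (hup 1 le_rfl)
    simpa using h1
  have hθ1 : θ ≤ 1 := by
    refine le_of_sq_le_sq ?_ zero_le_one
    rw [hθ2, div_le_iff₀ (by positivity)]
    linarith
  rw [← hθdef, ← hθ2]
  have hr0 : 0 < r := by linarith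
  rcases le_total 1 (θ * r) with h | h
  · have h1 := avOne_sub_le_rieszInt hn hf he he0 hlap x hr0 hθ hθ1
    have h2 := hlow r hr
    have h3 := hup (θ * r) h
    have h4 : D * (θ * r) ^ 2 = c * r ^ 2 / 2 := by
      rw [mul_pow, hθ2]
      field_simp
    have h5 : c * r ^ 2 / 2 ≤ rieszInt e x r / (2 * θ ^ n) := by linarith
    rw [le_div_iff₀ (by positivity)] at h5
    calc _ ≤ θ ^ n * c * r ^ 2 := by
          gcongr
          exact min_le_left _ _
      _ ≤ _ := by linarith
  · have h1 := mul_volume_le_rieszInt hn he.continuous he0 hr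
      (integrableOn_riesz hn hf he he0 hlap x hr0) hb
    refine le_trans ?_ h1
    have h2 : (θ * r) ^ 2 ≤ 1 := pow_le_one₀ (by positivity) h
    calc _ ≤ b * volume.real (ball (0 : EuclideanSpace ℝ (Fin n)) 1) * θ ^ 2 * r ^ 2 := by
          gcongr
          exact min_le_right _ _
      _ = b * volume.real (ball (0 : EuclideanSpace ℝ (Fin n)) 1) * (θ * r) ^ 2 := by ring
      _ ≤ b * volume.real (ball (0 : EuclideanSpace ℝ (Fin n)) 1) * 1 := by gcongr
      _ = _ := mul_one _

/-- Two-sided quadratic bounds for the singular integral of one component. -/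
theorem exists_rieszInt_bounds {n : ℕ} (hn : 2 ≤ n) {B c D : ℝ} (hc : 0 < c)
    (hD : 0 < D) : ∃ a A : ℝ, 0 < a ∧ 0 < A ∧
      ∀ {u v : EuclideanSpace ℝ (Fin n) → ℝ}, IsSolution u v →
        ∀ x, c ≤ u x → c ≤ v x → (∀ z, ‖z - x‖ ≤ 5 → u z ≤ B ∧ v z ≤ B) →
          (∀ R, 1 ≤ R → avOne (fun y => u y ^ 2) x R ≤ D * R ^ 2) →
          (∀ R, 1 ≤ R → c * R ^ 2 ≤ avOne (fun y => u y ^ 2) x R) →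
          ∀ r, 1 ≤ r → a * r ^ 2 ≤ rieszInt (fun y => gradSq u y + u y ^ 2 * v y ^ 2) x r ∧
            rieszInt (fun y => gradSq u y + u y ^ 2 * v y ^ 2) x r ≤ A * r ^ 2 := by
  obtain ⟨L, hL⟩ : ∃ L, L = 4 / 3 * (4 : ℝ) ^ n * Real.exp (2 * B ^ 2) := ⟨_, rfl⟩
  have hL0 : 0 < L := by rw [hL]; positivity
  have hvol : 0 < volume.real (ball (0 : EuclideanSpace ℝ (Fin n)) 1) :=
    ENNReal.toReal_pos (measure_ball_pos _ _ one_pos).ne' measure_ball_lt_top.ne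
  refine ⟨min (√(c / (2 * D)) ^ n * c) (((c / L) ^ 2 * (c / L) ^ 2) *
    volume.real (ball (0 : EuclideanSpace ℝ (Fin n)) 1) * (c / (2 * D))), 4 ^ n * (D * 16),
    by positivity, by positivity, fun {u v} hsol x hux hvx hbd hup hlow r hr => ?_⟩
  have he : ContDiff ℝ (⊤ : ℕ∞) fun y => gradSq u y + u y ^ 2 * v y ^ 2 :=
    (contDiff_gradSq hsol.1).add (hsol.contDiff_sq.mul hsol.swap.contDiff_sq)
  have he0 : ∀ y, 0 ≤ gradSq u y + u y ^ 2 * v y ^ 2 := fun y => by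
    have := gradSq_nonneg u y
    positivity
  constructor
  · refine le_rieszInt hn hsol.contDiff_sq he he0 hsol.lap_sq hc hD (by positivity) hlow hup
      (fun z hz => ?_) hr
    have hz1 : ‖z - x‖ < 1 := by rw [← dist_eq_norm]; exact hz
    have hball : ∀ w, ‖w - z‖ ≤ 4 → ‖w - x‖ ≤ 5 := fun w hw => by
      have := norm_add_le (w - z) (z - x)
      rw [sub_add_sub_cancel] at this
      linarith
    have hxz : ‖x - z‖ ≤ 1 := by rw [norm_sub_rev]; exact hz1.le
    have h1 := harnack hsol (fun w hw => (hbd w (hball w hw)).1) hxz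
    have h2 := harnack hsol.swap (fun w hw => (hbd w (hball w hw)).2) hxz
    rw [← hL, mul_comm] at h1 h2
    have h3 : c / L ≤ v z := (div_le_iff₀ hL0).2 (hvx.trans h1)
    have h4 : c / L ≤ u z := (div_le_iff₀ hL0).2 (hux.trans h2)
    have h5 := gradSq_nonneg u z
    have h6 : (c / L) ^ 2 * (c / L) ^ 2 ≤ u z ^ 2 * v z ^ 2 := by
      have := hsol.2.2.1 z
      have := hsol.2.2.2.1 z
      gcongr
    linarith
  · refine (rieszInt_le hn hsol.contDiff_sq (fun _ => sq_nonneg _) he he0 hsol.lap_sq x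
      (by linarith)).trans ?_
    have h1 := hup (4 * r) (by linarith)
    calc 4 ^ n * avOne (fun y => u y ^ 2) x (4 * r) ≤ 4 ^ n * (D * (4 * r) ^ 2) := by gcongr
      _ = _ := by ring

theorem Jfun_eq_rieszInt {n : ℕ} (u v : EuclideanSpace ℝ (Fin n) → ℝ)
    (x : EuclideanSpace ℝ (Fin n)) (r : ℝ) :
    Jfun u v x r = r ^ (-4 : ℝ) * (rieszInt (fun y => gradSq u y + u y ^ 2 * v y ^ 2) x r *
      rieszInt (fun y => gradSq v y + v y ^ 2 * u y ^ 2) x r) := by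
  simp only [Jfun, rieszInt, norm_gradient_sq, mul_comm (v _ ^ 2)]

/-- For an entire solution with linear growth there is a universal constant C > 0 such that
1/C ≤ J(r; x) ≤ C for every x ∈ {u = v} and every r ≥ 1. -/
theorem J_bounds_on_free_boundary {n : ℕ} (hn : 2 ≤ n)
    (u v : EuclideanSpace ℝ (Fin n) → ℝ) (hsol : IsSolution u v)
    (C₀ : ℝ) (hC₀ : 0 < C₀) (hgrowth : ∀ x, u x + v x ≤ C₀ * (1 + ‖x‖)) :
    ∃ C : ℝ, 0 < C ∧ ∀ x : EuclideanSpace ℝ (Fin n), u x = v x →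
      ∀ r : ℝ, 1 ≤ r → 1 / C ≤ Jfun u v x r ∧ Jfun u v x r ≤ C := by
  obtain ⟨B, c, D, -, hc, hD, hbounds⟩ := exists_uniform_bounds hn hsol hC₀ hgrowth
  obtain ⟨a, A, ha, hA, hriesz⟩ := exists_rieszInt_bounds (B := B) hn hc hD
  refine ⟨A ^ 2 + 1 / a ^ 2, by positivity, fun x hx r hr => ?_⟩
  obtain ⟨hux, hbd, hR⟩ := hbounds x hx
  have hvx : c ≤ v x := hx ▸ hux
  have hr0 : 0 < r := by linarith
  obtain ⟨hIu, hIu'⟩ := hriesz hsol x hux hvx hbd (fun R h => (hR R h).1.1)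
    (fun R h => (hR R h).2.1) r hr
  obtain ⟨hIv, hIv'⟩ := hriesz hsol.swap x hvx hux (fun z hz => (hbd z hz).symm)
    (fun R h => (hR R h).1.2) (fun R h => (hR R h).2.2) r hr
  have hr4 : r ^ (-4 : ℝ) = (r ^ 4)⁻¹ := by
    rw [Real.rpow_neg hr0.le]
    norm_cast
  have hlow : a ^ 2 ≤ Jfun u v x r := by
    rw [Jfun_eq_rieszInt, hr4, le_inv_mul_iff₀ (by positivity)]
    calc r ^ 4 * a ^ 2 = (a * r ^ 2) * (a * r ^ 2) := by ring
      _ ≤ _ := mul_le_mul hIu hIv (by positivity) (le_trans (by positivity) hIu)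
  have hup : Jfun u v x r ≤ A ^ 2 := by
    rw [Jfun_eq_rieszInt, hr4, inv_mul_le_iff₀ (by positivity)]
    calc _ ≤ (A * r ^ 2) * (A * r ^ 2) :=
          mul_le_mul hIu' hIv' (le_trans (by positivity) hIv) (by positivity)
      _ = _ := by ring
  constructor
  · refine le_trans ?_ hlow
    rw [div_le_iff₀ (by positivity), mul_add, mul_one_div_cancel (by positivity)]
    nlinarith [mul_pos (pow_pos ha 2) (pow_pos hA 2)]
  · have : 0 < 1 / a ^ 2 := by positivity
    linarith
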